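/- arXiv:1106.1857 — 2 statements merged into one kernel-verified Lean document; each statement's English description precedes it below -/
import Mathlib

section
/- Let L be a countable set, l : L → ℝ a function with l(γ) ≥ l₀ for all γ ∈ L for some constant l₀ > 0, w : L → [0,∞) a weight, and η > 0. Assume: (a) for every real σ > η the double series Σ_{γ∈L} Σ_{k≥1} w(γ)^k · e^{−k·σ·l(γ)}/k converges, so that Z(s) := exp( Σ_{γ∈L} Σ_{k≥1} w(γ)^k · e^{−k·s·l(γ)}/k ) is defined and analytic on {Re(s) > η}; and (b) there exist an open set U ⊆ ℂ containing the closed half-plane {s : Re(s) ≥ η} and an analytic function g on U with g(s) ≠ 0 for all s ∈ U, such that Z(s) = g(s)/(s−η) for every s ∈ U with Re(s) > η. Then the nondecreasing function ψ(T) := Σ_{(γ,k) ∈ L×ℕ≥1 with k·l(γ) ≤ T} l(γ)·w(γ)^k satisfies e^{−ηT}·ψ(T) → 1/η as T → ∞. -/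
/-- The logarithm of the weighted dynamical zeta function:
`F(s) = Σ_{γ∈L} Σ_{k≥1} w(γ)^k e^{-k s l(γ)} / k`, where `k = p.2 + 1`. -/
noncomputable def zetaLog {L : Type*} (l w : L → ℝ) (s : ℂ) : ℂ :=
  ∑' p : L × ℕ, (w p.1 : ℂ) ^ (p.2 + 1) *
    Complex.exp (-((p.2 : ℂ) + 1) * s * (l p.1 : ℂ)) / ((p.2 : ℂ) + 1)

open MeasureTheory Filter Topology Set

namespace WZ

/-- triangle function -/
noncomputable def tri (t : ℝ) : ℝ := max 0 (1 - |t|)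

/-- Fejer kernel -/
noncomputable def K0 (x : ℝ) : ℝ := if x = 0 then 1 else 2 * (1 - Real.cos x) / x ^ 2

lemma tri_cont : Continuous tri := by unfold tri; fun_prop

lemma tri_supp {t : ℝ} (ht : t ∉ Icc (-1 : ℝ) 1) : tri t = 0 := by
  unfold tri
  rw [max_eq_left]
  by_contra h
  push Not at h
  exact ht (abs_le.mp (by linarith))

lemma tri_hcs : HasCompactSupport tri :=
  HasCompactSupport.intro isCompact_Icc fun _ h => tri_supp h

lemma half_int (c : ℂ) (hc : c ≠ 0) :
    ∫ t in (0:ℝ)..1, (1 - (t:ℂ)) * Complex.exp (c * t) =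
      Complex.exp c / c ^ 2 - 1 / c - 1 / c ^ 2 := by
  have hd : ∀ t : ℝ, HasDerivAt (fun t : ℝ => (1 - (t:ℂ)) * Complex.exp (c * t) / c
      + Complex.exp (c * t) / c ^ 2) ((1 - (t:ℂ)) * Complex.exp (c * t)) t := by
    intro t
    have h1 : HasDerivAt (fun t : ℝ => (t:ℂ)) 1 t := Complex.ofRealCLM.hasDerivAt
    have h2 : HasDerivAt (fun t : ℝ => Complex.exp (c * t)) (Complex.exp (c * t) * (c * 1)) t :=
      (h1.const_mul c).cexp
    have h3 := (((h1.const_sub 1).mul h2).div_const c).add (h2.div_const (c ^ 2))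
    convert! h3 using 1
    field_simp
    ring
  rw [intervalIntegral.integral_eq_sub_of_hasDerivAt (fun t _ => hd t)
    (Continuous.intervalIntegrable (by fun_prop) _ _)]
  simp
  ring

lemma tri_fourier_ne (x : ℝ) (hx : x ≠ 0) :
    ∫ t : ℝ, (tri t : ℂ) * Complex.exp (-(Complex.I * t * x)) = (K0 x : ℂ) := by
  have hc : Complex.I * x ≠ 0 := mul_ne_zero Complex.I_ne_zero (by exact_mod_cast hx)
  have hcont : Continuous fun t : ℝ => (tri t : ℂ) * Complex.exp (-(Complex.I * t * x)) := by
    have := tri_cont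
    fun_prop
  have h1 : ∫ t : ℝ, (tri t : ℂ) * Complex.exp (-(Complex.I * t * x)) =
      ∫ t in (-1:ℝ)..1, (tri t : ℂ) * Complex.exp (-(Complex.I * t * x)) := by
    rw [intervalIntegral.integral_of_le (by norm_num), ← integral_Icc_eq_integral_Ioc,
      setIntegral_eq_integral_of_forall_compl_eq_zero]
    intro t ht
    rw [tri_supp ht]; simp
  rw [h1, ← intervalIntegral.integral_add_adjacent_intervals (b := 0)
    (hcont.intervalIntegrable _ _) (hcont.intervalIntegrable _ _)]
  have h2 : ∫ t in (0:ℝ)..1, (tri t : ℂ) * Complex.exp (-(Complex.I * t * x)) =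
      ∫ t in (0:ℝ)..1, (1 - (t:ℂ)) * Complex.exp ((-(Complex.I * x)) * t) := by
    apply intervalIntegral.integral_congr
    intro t ht
    rw [uIcc_of_le (by norm_num)] at ht
    simp only [tri]
    rw [abs_of_nonneg ht.1, max_eq_right (by linarith [ht.2])]
    push_cast; congr 2; ring
  have h3 : ∫ t in (-1:ℝ)..0, (tri t : ℂ) * Complex.exp (-(Complex.I * t * x)) =
      ∫ t in (0:ℝ)..1, (1 - (t:ℂ)) * Complex.exp (((Complex.I * x)) * t) := by
    have := intervalIntegral.integral_comp_neg (a := 0) (b := 1)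
      (fun t : ℝ => (tri t : ℂ) * Complex.exp (-(Complex.I * t * x)))
    rw [neg_zero] at this
    rw [← this]
    apply intervalIntegral.integral_congr
    intro t ht
    rw [uIcc_of_le (by norm_num)] at ht
    simp only [tri]
    rw [abs_neg, abs_of_nonneg ht.1, max_eq_right (by linarith [ht.2])]
    push_cast; congr 2; ring
  rw [h2, h3, half_int _ hc, half_int _ (neg_ne_zero.mpr hc)]
  have hcos : Complex.exp (Complex.I * x) + Complex.exp (-(Complex.I * x)) = 2 * Complex.cos x := by
    rw [Complex.cos]; rw [mul_comm]; ring_nf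
  have hxC : (x : ℂ) ≠ 0 := by exact_mod_cast hx
  simp only [K0, hx, if_false]
  push_cast
  have : Complex.exp (Complex.I * x) = 2 * Complex.cos x - Complex.exp (-(Complex.I * x)) := by
    rw [← hcos]; ring
  rw [this]
  have hI : (Complex.I * x)^2 = - (x:ℂ)^2 := by rw [mul_pow, Complex.I_sq]; ring
  rw [neg_sq, hI]
  field_simp
  ring

lemma tri_fourier_zero :
    ∫ t : ℝ, (tri t : ℂ) = 1 := by
  have h1 : ∫ t : ℝ, tri t = ∫ t in (-1:ℝ)..1, tri t := by
    rw [intervalIntegral.integral_of_le (by norm_num), ← integral_Icc_eq_integral_Ioc,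
      setIntegral_eq_integral_of_forall_compl_eq_zero]
    intro t ht
    rw [tri_supp ht]
  rw [integral_complex_ofReal, h1, ← intervalIntegral.integral_add_adjacent_intervals (b := 0)
    (tri_cont.intervalIntegrable _ _) (tri_cont.intervalIntegrable _ _)]
  have h2 : ∫ t in (0:ℝ)..1, tri t = ∫ t in (0:ℝ)..1, (1 - t) := by
    apply intervalIntegral.integral_congr
    intro t ht
    rw [uIcc_of_le (by norm_num)] at ht
    simp only [tri]
    rw [abs_of_nonneg ht.1, max_eq_right (by linarith [ht.2])]
  have h3 : ∫ t in (-1:ℝ)..0, tri t = ∫ t in (-1:ℝ)..0, (1 + t) := by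
    apply intervalIntegral.integral_congr
    intro t ht
    rw [uIcc_of_le (by norm_num)] at ht
    simp only [tri]
    rw [abs_of_nonpos ht.2, max_eq_right (by linarith [ht.1])]
    ring
  rw [h2, h3]
  rw [intervalIntegral.integral_add (by simp) (by simp),
    intervalIntegral.integral_sub (by simp) (by simp)]
  norm_num [integral_id]

lemma tri_fourier (x : ℝ) :
    ∫ t : ℝ, (tri t : ℂ) * Complex.exp (-(Complex.I * t * x)) = (K0 x : ℂ) := by
  by_cases hx : x = 0
  · subst hx
    simp [K0, tri_fourier_zero]
  · exact tri_fourier_ne x hx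

lemma K0_mul (x : ℝ) : K0 x * x ^ 2 = 2 * (1 - Real.cos x) := by
  unfold K0
  split_ifs with h
  · simp [h]
  · field_simp

lemma K0_nonneg (x : ℝ) : 0 ≤ K0 x := by
  unfold K0
  split_ifs with h
  · simp
  · have := Real.cos_le_one x
    exact div_nonneg (by linarith) (by positivity)

lemma K0_le_one (x : ℝ) : K0 x ≤ 1 := by
  unfold K0
  split_ifs with h
  · simp
  · rw [div_le_one (by positivity)]
    have := Real.one_sub_sq_div_two_le_cos (x := x)
    linarith

lemma K0_bound (x : ℝ) : K0 x ≤ 5 * (1 + x ^ 2)⁻¹ := by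
  rw [← div_eq_mul_inv, le_div_iff₀ (by positivity), mul_add, mul_one, K0_mul]
  linarith [K0_le_one x, Real.neg_one_le_cos x]

lemma ft_cont (f : ℝ → ℂ) (hf : Continuous f) (hs : HasCompactSupport f) :
    Continuous fun x : ℝ => ∫ t : ℝ, f t * Complex.exp (-(Complex.I * t * x)) := by
  refine continuous_of_dominated (bound := fun t => ‖f t‖) ?_ ?_ ?_ ?_
  · intro x
    exact Continuous.aestronglyMeasurable (by fun_prop)
  · intro x
    refine Eventually.of_forall fun t => ?_
    rw [norm_mul, Complex.norm_exp]
    simp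
  · exact (hf.integrable_of_hasCompactSupport hs).norm
  · exact Eventually.of_forall fun t => by fun_prop

lemma K0_cont : Continuous K0 := by
  have h := ft_cont (fun t => (tri t : ℂ)) (by have := tri_cont; fun_prop)
    (tri_hcs.comp_left (g := fun x : ℝ => (x : ℂ)) (by simp))
  simp only [tri_fourier] at h
  exact (Complex.continuous_re.comp h)

/-- strictly positive kernel -/
noncomputable def K (x : ℝ) : ℝ := K0 x + K0 (x + Real.pi)

noncomputable def fK (t : ℝ) : ℂ := (tri t : ℂ) * (1 + Complex.exp (-(Complex.I * t * Real.pi)))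

lemma fK_cont : Continuous fK := by
  have := tri_cont
  unfold fK; fun_prop

lemma fK_hcs : HasCompactSupport fK :=
  HasCompactSupport.intro (K := Icc (-1) 1) isCompact_Icc fun t ht => by simp [fK, tri_supp ht]

lemma fK_fourier (x : ℝ) :
    ∫ t : ℝ, fK t * Complex.exp (-(Complex.I * t * x)) = (K x : ℂ) := by
  have hi : ∀ x : ℝ, Integrable fun t : ℝ => (tri t : ℂ) * Complex.exp (-(Complex.I * t * x)) := by
    intro x
    apply Continuous.integrable_of_hasCompactSupport
    · have := tri_cont
      fun_prop
    · exact HasCompactSupport.intro (K := Icc (-1) 1) isCompact_Icc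
        fun t ht => by simp [tri_supp ht]
  unfold K
  push_cast
  rw [← tri_fourier, ← tri_fourier, ← integral_add (hi _) (hi _)]
  congr 1; ext t
  unfold fK
  push_cast
  rw [mul_add (Complex.I * t), neg_add, Complex.exp_add]
  ring

lemma K_cont : Continuous K := by
  have := K0_cont
  unfold K; fun_prop

lemma K_lower (x : ℝ) : 4 ≤ K x * (|x| + Real.pi) ^ 2 := by
  have h1 := K0_mul x
  have h2 := K0_mul (x + Real.pi)
  rw [Real.cos_add_pi] at h2
  have h3 : x ^ 2 ≤ (|x| + Real.pi) ^ 2 := by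
    rw [← sq_abs x]; have := abs_nonneg x; have := Real.pi_pos; gcongr; linarith
  have h4 : (x + Real.pi) ^ 2 ≤ (|x| + Real.pi) ^ 2 := by
    rw [← sq_abs (x + Real.pi)]
    gcongr
    exact (abs_add_le _ _).trans (by rw [abs_of_pos Real.pi_pos])
  have h5 := mul_le_mul_of_nonneg_left h3 (K0_nonneg x)
  have h6 := mul_le_mul_of_nonneg_left h4 (K0_nonneg (x + Real.pi))
  unfold K
  linarith

lemma K_pos (x : ℝ) : 0 < K x := by
  by_contra h
  push Not at h
  have := K_lower x
  have h2 := mul_nonpos_of_nonpos_of_nonneg h (sq_nonneg (|x| + Real.pi))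
  linarith

lemma K_int : Integrable K := by
  have h0 : Integrable K0 := by
    refine (integrable_inv_one_add_sq.const_mul 5).mono' K0_cont.aestronglyMeasurable ?_
    refine Eventually.of_forall fun x => ?_
    rw [Real.norm_of_nonneg (K0_nonneg x)]
    exact K0_bound x
  exact h0.add (h0.comp_add_right Real.pi)

/-- `e^{η x}/K` is bounded on `x ≤ 1`. -/
lemma exp_div_K_bound (η : ℝ) (hη : 0 < η) : ∃ C, ∀ x ≤ 1, Real.exp (η * x) / K x ≤ C := by
  refine ⟨Real.exp (η * (2 + Real.pi)) * (2 / η ^ 2) / 4, fun x hx => ?_⟩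
  rw [div_le_iff₀ (K_pos x)]
  have hu : 0 ≤ |x| + Real.pi := by positivity
  set u := |x| + Real.pi with hudef
  have h1 : Real.exp (η * x) ≤ Real.exp (η * (2 + Real.pi)) * Real.exp (-(η * u)) := by
    rw [← Real.exp_add, Real.exp_le_exp]
    have : x ≤ 2 - |x| := by
      rcases abs_cases x with h | h <;> linarith
    have := mul_le_mul_of_nonneg_left this hη.le
    rw [hudef]; linarith
  have h2 : Real.exp (-(η * u)) * u ^ 2 ≤ 2 / η ^ 2 := by
    rw [Real.exp_neg, inv_mul_le_iff₀ (Real.exp_pos _), mul_div_assoc', le_div_iff₀ (by positivity)]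
    have := Real.quadratic_le_exp_of_nonneg (x := η * u) (by positivity)
    have h0 : 0 ≤ η * u := by positivity
    nlinarith
  have h3 := K_lower x
  rw [← hudef] at h3
  have hKp := K_pos x
  calc Real.exp (η * x) ≤ Real.exp (η * (2 + Real.pi)) * Real.exp (-(η * u)) * 1 := by
        rw [mul_one]; exact h1
    _ ≤ Real.exp (η * (2 + Real.pi)) * Real.exp (-(η * u)) * (K x * u ^ 2 / 4) := by
        gcongr; linarith
    _ = Real.exp (η * (2 + Real.pi)) * (Real.exp (-(η * u)) * u ^ 2) / 4 * K x := by ring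
    _ ≤ Real.exp (η * (2 + Real.pi)) * (2 / η ^ 2) / 4 * K x := by gcongr


/-- Fubini -/
lemma fubini (m : Measure ℝ) [SFinite m] (δ y : ℝ)
    (hm : Integrable (fun x => Real.exp (-(δ * x))) m)
    (f : ℝ → ℂ) (hf : Continuous f) (hs : HasCompactSupport f) :
    ∫ x, (Real.exp (-(δ * x)) : ℂ) * (∫ t : ℝ, f t * Complex.exp (-(Complex.I * t * (x - y : ℝ)))) ∂m
      = ∫ t : ℝ, f t * Complex.exp (Complex.I * t * y) *
          ∫ x : ℝ, Complex.exp (-((δ + Complex.I * t) * x)) ∂m := by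
  have hfi := hf.integrable_of_hasCompactSupport hs (μ := volume)
  have hI : Integrable (Function.uncurry fun (x t : ℝ) => (Real.exp (-(δ * x)) : ℂ) *
      (f t * Complex.exp (-(Complex.I * t * (x - y : ℝ))))) (m.prod volume) := by
    have h0 := hm.ofReal (𝕜 := ℂ) |>.mul_prod hfi
    refine h0.mono (Continuous.aestronglyMeasurable ?_) (Eventually.of_forall ?_)
    · simp only [Function.uncurry_def]
      fun_prop
    · rintro ⟨x, t⟩
      simp [Function.uncurry, Complex.norm_exp]
  simp_rw [← integral_const_mul]
  rw [integral_integral_swap hI]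
  congr 1; ext t
  congr 1; ext x
  push_cast
  rw [mul_left_comm, ← Complex.exp_add, mul_assoc (f t), ← Complex.exp_add]
  congr 2
  ring

lemma lebint {δ : ℝ} (hδ : 0 < δ) :
    Integrable (fun x => Real.exp (-(δ * x))) (volume.restrict (Ioi 0)) := by
  simpa [IntegrableOn, neg_mul] using integrableOn_exp_mul_Ioi (a := -δ) (by linarith) 0

lemma lebval {δ : ℝ} (hδ : 0 < δ) (t : ℝ) :
    ∫ x : ℝ in Ioi 0, Complex.exp (-((δ + Complex.I * t) * x)) = 1 / (δ + Complex.I * t) := by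
  have := integral_exp_mul_complex_Ioi (a := -(δ + Complex.I * t)) (by simpa using hδ) 0
  simp only [neg_mul] at this
  rw [this, neg_div_neg_eq]
  simp

/-- the hypotheses -/
structure Hyp (m : Measure ℝ) (H : ℂ → ℂ) : Prop where
  nonneg : ∀ᵐ x ∂m, 0 ≤ x
  int : ∀ δ : ℝ, 0 < δ → Integrable (fun x => Real.exp (-(δ * x))) m
  cont : ContinuousOn H {s | 0 ≤ s.re}
  eq : ∀ s : ℂ, 0 < s.re → ∫ x : ℝ, Complex.exp (-(s * x)) ∂m = 1 / s + H s

variable {m : Measure ℝ} [SFinite m] {H : ℂ → ℂ}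

noncomputable def ft (f : ℝ → ℂ) (x : ℝ) : ℂ := ∫ t : ℝ, f t * Complex.exp (-(Complex.I * t * x))

lemma Hyp.cont' (h : Hyp m H) : Continuous fun p : ℝ × ℝ => H (|p.1| + Complex.I * p.2) := by
  refine h.cont.comp_continuous (by fun_prop) ?_
  intro p
  simp

lemma identity (h : Hyp m H) (f : ℝ → ℂ) (hf : Continuous f) (hs : HasCompactSupport f)
    {δ : ℝ} (hδ : 0 < δ) (y : ℝ) :
    ∫ x, (Real.exp (-(δ * x)) : ℂ) * ft f (x - y) ∂m =
      (∫ x in Ioi 0, (Real.exp (-(δ * x)) : ℂ) * ft f (x - y)) +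
      ∫ t : ℝ, f t * Complex.exp (Complex.I * t * y) * H (|δ| + Complex.I * t) := by
  unfold ft
  rw [fubini m δ y (h.int δ hδ) f hf hs, fubini _ δ y (lebint hδ) f hf hs, ← integral_add]
  · congr 1; ext t
    rw [lebval hδ, h.eq _ (by simpa using hδ), abs_of_pos hδ]
    ring
  · simp_rw [lebval hδ]
    apply Continuous.integrable_of_hasCompactSupport
    · refine Continuous.mul (by fun_prop) (Continuous.div (by fun_prop) (by fun_prop) ?_)
      intro t ht
      have := congrArg Complex.re ht
      simp at this
      linarith
    · simp_rw [mul_assoc]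
      exact hs.mul_right
  · apply Continuous.integrable_of_hasCompactSupport
    · refine Continuous.mul (by fun_prop) ?_
      exact h.cont'.comp (Continuous.prodMk_right δ)
    · simp_rw [mul_assoc]
      exact hs.mul_right

lemma err_tendsto (h : Hyp m H) (f : ℝ → ℂ) (hf : Continuous f) (hs : HasCompactSupport f) (y : ℝ) :
    Continuous fun δ : ℝ =>
      ∫ t : ℝ, f t * Complex.exp (Complex.I * t * y) * H (|δ| + Complex.I * t) := by
  have key := continuous_parametric_integral_of_continuous (μ := (volume : Measure ℝ))
    (f := fun δ t : ℝ => f t * Complex.exp (Complex.I * t * y) * H (|δ| + Complex.I * t))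
    (by
      have := h.cont'
      simp only [Function.uncurry_def]
      exact Continuous.mul (by fun_prop) this) (s := tsupport f) hs
  convert! key using 2 with δ
  rw [setIntegral_eq_integral_of_forall_compl_eq_zero]
  intro t ht
  rw [image_eq_zero_of_notMem_tsupport ht]; simp

/-- the sequence of parameters -/
noncomputable def dl (n : ℕ) : ℝ := 1 / ((n : ℝ) + 1)
lemma dl_pos (n : ℕ) : 0 < dl n := by unfold dl; positivity
lemma dl_lim : Tendsto dl atTop (𝓝 0) := tendsto_one_div_add_atTop_nhds_zero_nat

lemma ft_cont' (f : ℝ → ℂ) (hf : Continuous f) (hs : HasCompactSupport f) :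
    Continuous (ft f) := by
  unfold ft
  refine continuous_of_dominated (bound := fun t => ‖f t‖) ?_ ?_ ?_ ?_
  · intro x
    exact Continuous.aestronglyMeasurable (by fun_prop)
  · intro x
    refine Eventually.of_forall fun t => ?_
    rw [norm_mul, Complex.norm_exp]
    simp
  · exact (hf.integrable_of_hasCompactSupport hs).norm
  · exact Eventually.of_forall fun t => by fun_prop

lemma dom_lim (m : Measure ℝ) (hm : ∀ᵐ x ∂m, 0 ≤ x) (F : ℝ → ℂ) (hF : Integrable F m) :
    Tendsto (fun n => ∫ x, (Real.exp (-(dl n * x)) : ℂ) * F x ∂m) atTop (𝓝 (∫ x, F x ∂m)) := by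
  refine tendsto_integral_of_dominated_convergence (fun x => ‖F x‖) ?_ hF.norm ?_ ?_
  · intro n
    exact (Continuous.aestronglyMeasurable (by fun_prop)).mul hF.aestronglyMeasurable
  · intro n
    filter_upwards [hm] with x hx
    rw [norm_mul]
    refine mul_le_of_le_one_left (norm_nonneg _) ?_
    rw [Complex.norm_real, Real.norm_of_nonneg (Real.exp_pos _).le, Real.exp_le_one_iff]
    have := mul_nonneg (dl_pos n).le hx
    linarith
  · refine Eventually.of_forall fun x => ?_
    have h1 : Tendsto (fun n => -(dl n * x)) atTop (𝓝 (-(0 * x))) := (dl_lim.mul_const x).neg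
    have h2 := ((Complex.continuous_ofReal.comp Real.continuous_exp).tendsto _).comp h1
    have h3 := h2.mul_const (F x)
    simpa using h3

lemma lebdom (F : ℝ → ℂ) (hF : Integrable F) (y : ℝ) :
    Tendsto (fun n => ∫ x in Ioi 0, (Real.exp (-(dl n * x)) : ℂ) * F (x - y)) atTop
      (𝓝 (∫ x in Ioi 0, F (x - y))) := by
  refine dom_lim _ ?_ _ (hF.comp_sub_right y).integrableOn
  exact (ae_restrict_iff' measurableSet_Ioi).mpr (Eventually.of_forall fun x hx => le_of_lt hx)

/-- convergence for δ → 0 of the left hand side -/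
lemma lhs_tendsto (h : Hyp m H) (f : ℝ → ℂ) (hf : Continuous f) (hs : HasCompactSupport f)
    (hi : Integrable (ft f)) (y : ℝ) :
    Tendsto (fun n => ∫ x, (Real.exp (-(dl n * x)) : ℂ) * ft f (x - y) ∂m) atTop
      (𝓝 ((∫ x in Ioi 0, ft f (x - y)) +
        ∫ t : ℝ, f t * Complex.exp (Complex.I * t * y) * H (Complex.I * t))) := by
  simp_rw [fun n => identity h f hf hs (dl_pos n) y]
  refine (lebdom _ hi y).add ?_
  have := ((err_tendsto h f hf hs y).tendsto 0).comp dl_lim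
  simpa using! this

lemma integrable_pos (h : Hyp m H) (f : ℝ → ℂ) (hf : Continuous f) (hs : HasCompactSupport f)
    (hi : Integrable (ft f)) (k : ℝ → ℝ) (hk : ∀ x, 0 ≤ k x) (hkf : ∀ x, ft f x = k x)
    (hkb : ∃ C, ∀ x, k x ≤ C) (y : ℝ) :
    Integrable (fun x => k (x - y)) m := by
  have hkc : Continuous k := by
    have := Complex.continuous_re.comp (ft_cont' f hf hs)
    have he : k = Complex.re ∘ ft f := by ext x; simp [hkf]
    rw [he]; exact this
  obtain ⟨C, hC⟩ := hkb
  have hInt0 : ∀ n, Integrable (fun x => Real.exp (-(dl n * x)) * k (x - y)) m := by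
    intro n
    refine (h.int _ (dl_pos n)).mul_bdd (c := C) (Continuous.aestronglyMeasurable (by fun_prop)) ?_
    refine Eventually.of_forall fun x => ?_
    rw [Real.norm_of_nonneg (hk _)]; exact hC _
  refine integrable_of_tendsto (G := fun n x => Real.exp (-(dl n * x)) * k (x - y)) ?_
    (fun n => Continuous.aestronglyMeasurable (by fun_prop)) ?_
  · refine Eventually.of_forall fun x => ?_
    have h1 : Tendsto (fun n => -(dl n * x)) atTop (𝓝 (-(0 * x))) := (dl_lim.mul_const x).neg
    have h2 := (Real.continuous_exp.tendsto _).comp h1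
    have h3 := h2.mul_const (k (x - y))
    simpa using h3
  · have hl := (Complex.continuous_re.tendsto _).comp (lhs_tendsto h f hf hs hi y)
    have hl2 := (ENNReal.continuous_ofReal.tendsto _).comp hl
    have : (fun n => ∫⁻ x, ‖Real.exp (-(dl n * x)) * k (x - y)‖ₑ ∂m) =
        ENNReal.ofReal ∘ Complex.re ∘ 
          fun n => ∫ x, (Real.exp (-(dl n * x)) : ℂ) * ft f (x - y) ∂m := by
      ext n
      simp only [Function.comp, hkf]
      rw [← ofReal_integral_norm_eq_lintegral_enorm (hInt0 n)]
      congr 1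
      simp_rw [← Complex.ofReal_mul]
      rw [integral_complex_ofReal, Complex.ofReal_re]
      congr 1; ext x
      exact Real.norm_of_nonneg (mul_nonneg (Real.exp_pos _).le (hk _))
    rw [this, hl2.liminf_eq]
    exact ENNReal.ofReal_ne_top

lemma main_tendsto (h : Hyp m H) (f : ℝ → ℂ) (hf : Continuous f) (hs : HasCompactSupport f)
    (hi : Integrable (ft f)) (him : ∀ y, Integrable (fun x => ft f (x - y)) m) :
    Tendsto (fun y => ∫ x, ft f (x - y) ∂m) atTop (𝓝 (∫ x, ft f x)) := by
  have h1 : ∀ y, ∫ x, ft f (x - y) ∂m = (∫ x in Ioi 0, ft f (x - y)) +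
        ∫ t : ℝ, f t * Complex.exp (Complex.I * t * y) * H (Complex.I * t) := fun y =>
    tendsto_nhds_unique (dom_lim m h.nonneg _ (him y)) (lhs_tendsto h f hf hs hi y)
  simp_rw [h1]
  rw [← add_zero (∫ x, ft f x)]
  refine Tendsto.add ?_ ?_
  · have h2 : ∀ y : ℝ, ∫ x in Ioi 0, ft f (x - y) = ∫ x in Ioi (-y), ft f x := by
      intro y
      rw [← integral_indicator measurableSet_Ioi, ← integral_indicator measurableSet_Ioi,
        ← integral_sub_right_eq_self ((Ioi (-y)).indicator fun x => ft f x) y]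
      congr 1; ext x
      simp [indicator]
    simp_rw [h2]
    exact (aecover_Ioi tendsto_neg_atTop_atBot).integral_tendsto_of_countably_generated hi
  · have h3 := Real.tendsto_integral_exp_smul_cocompact (fun t : ℝ => f t * H (Complex.I * t))
    have h4 : Tendsto (fun y : ℝ => -(y / (2 * Real.pi))) atTop (cocompact ℝ) := by
      refine Tendsto.mono_right ?_ atBot_le_cocompact
      exact tendsto_neg_atTop_atBot.comp (tendsto_id.atTop_div_const (by positivity))
    refine (h3.comp h4).congr fun y => ?_
    simp only [Function.comp]
    congr 1; ext t
    rw [Circle.smul_def, Real.fourierChar_apply, smul_eq_mul]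
    have : ((2 * Real.pi * -(t * -(y / (2 * Real.pi))) : ℝ) : ℂ) * Complex.I = Complex.I * t * y := by
      push_cast
      have : (Real.pi : ℂ) ≠ 0 := by exact_mod_cast Real.pi_ne_zero
      field_simp
    rw [this]; ring

lemma charFun_normalize (μ : FiniteMeasure ℝ) (h0 : μ ≠ 0) (t : ℝ) :
    charFun (μ.normalize : Measure ℝ) t = ((μ.mass : ℝ) : ℂ)⁻¹ * charFun (μ : Measure ℝ) t := by
  rw [FiniteMeasure.toMeasure_normalize_eq_of_nonzero _ h0, charFun, charFun,
    integral_smul_nnreal_measure, NNReal.smul_def, Complex.real_smul]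
  push_cast
  rfl

lemma levy_finite (μ : ℕ → FiniteMeasure ℝ) (μ0 : FiniteMeasure ℝ) (h0 : μ0 ≠ 0)
    (h : ∀ t, Tendsto (fun n => charFun (μ n : Measure ℝ) t) atTop
      (𝓝 (charFun (μ0 : Measure ℝ) t))) : Tendsto μ atTop (𝓝 μ0) := by
  have hmass : Tendsto (fun n => (μ n).mass) atTop (𝓝 μ0.mass) := by
    have h1 := (Complex.continuous_re.tendsto _).comp (h 0)
    rw [← NNReal.tendsto_coe]
    simpa [Function.comp_def, charFun_zero] using! h1
  have hne : ∀ᶠ n in atTop, μ n ≠ 0 := by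
    simp_rw [← FiniteMeasure.mass_nonzero_iff]
    exact hmass.eventually_ne (μ0.mass_nonzero_iff.mpr h0)
  refine FiniteMeasure.tendsto_of_tendsto_normalize_testAgainstNN_of_tendsto_mass ?_ hmass
  rw [ProbabilityMeasure.tendsto_iff_tendsto_charFun]
  intro t
  rw [charFun_normalize _ h0]
  have h2 : Tendsto (fun n => (((μ n).mass : ℝ) : ℂ)⁻¹ * charFun (μ n : Measure ℝ) t) atTop
      (𝓝 (((μ0.mass : ℝ) : ℂ)⁻¹ * charFun (μ0 : Measure ℝ) t)) := by
    refine Tendsto.mul (Tendsto.inv₀ ?_ ?_) (h t)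
    · exact (Complex.continuous_ofReal.tendsto _).comp (NNReal.tendsto_coe.mpr hmass)
    · exact_mod_cast μ0.mass_nonzero_iff.mpr h0
  refine h2.congr' ?_
  filter_upwards [hne] with n hn
  rw [charFun_normalize _ hn]

lemma ft_fK (x : ℝ) : ft fK x = K x := fK_fourier x

lemma K_le_two (x : ℝ) : K x ≤ 2 := by
  unfold K; linarith [K0_le_one x, K0_le_one (x + Real.pi)]

lemma K_integrable (h : Hyp m H) (y : ℝ) : Integrable (fun x => K (x - y)) m :=
  integrable_pos h fK fK_cont fK_hcs (by simp only [ft_fK, funext ft_fK]; exact K_int.ofReal) K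
    (fun x => (K_pos x).le) ft_fK ⟨2, K_le_two⟩ y

lemma ft_shift (t x : ℝ) :
    ft (fun u => fK (u + t)) x = Complex.exp (t * x * Complex.I) * K x := by
  rw [← ft_fK]
  unfold ft
  rw [← integral_const_mul, ← integral_add_right_eq_self
    (fun u : ℝ => Complex.exp (t * x * Complex.I) * (fK u * Complex.exp (-(Complex.I * u * x)))) t]
  congr 1; ext u
  rw [mul_left_comm, ← Complex.exp_add]
  congr 2
  push_cast; ring

lemma char_tendsto (h : Hyp m H) (t : ℝ) :
    Tendsto (fun y => ∫ x, Complex.exp (t * (x - y : ℝ) * Complex.I) * K (x - y) ∂m) atTop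
      (𝓝 (∫ x : ℝ, Complex.exp (t * x * Complex.I) * K x)) := by
  have := main_tendsto h (fun u => fK (u + t)) (by have := fK_cont; fun_prop)
    (fK_hcs.comp_homeomorph (Homeomorph.addRight t)) ?_ ?_
  · simpa only [ft_shift] using this
  · simp only [funext (ft_shift t)]
    refine (K_int.ofReal (𝕜 := ℂ)).bdd_mul (c := 1) (Continuous.aestronglyMeasurable (by fun_prop)) ?_
    refine Eventually.of_forall fun x => ?_
    simp [Complex.norm_exp]
  · intro y
    simp only [funext (ft_shift t), ft_shift]
    refine ((K_integrable h y).ofReal (𝕜 := ℂ)).bdd_mul (c := 1)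
      (Continuous.aestronglyMeasurable (by fun_prop)) ?_
    refine Eventually.of_forall fun x => ?_
    simp [Complex.norm_exp]

/-- weighted shifted measure -/
noncomputable def wm (m : Measure ℝ) (y : ℝ) : Measure ℝ :=
  (m.withDensity fun x => ENNReal.ofReal (K (x - y))).map (fun x => x - y)

lemma wm_integral {E : Type*} [NormedAddCommGroup E] [NormedSpace ℝ E] (m : Measure ℝ) (y : ℝ)
    (φ : ℝ → E) (hφ : Continuous φ) :
    ∫ x, φ x ∂(wm m y) = ∫ x, K (x - y) • φ (x - y) ∂m := by
  unfold wm
  have hc := K_cont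
  rw [integral_map (by fun_prop) hφ.aestronglyMeasurable,
    integral_withDensity_eq_integral_toReal_smul (by fun_prop) (by simp)]
  congr 1; ext x
  rw [ENNReal.toReal_ofReal (K_pos _).le]

lemma wm_finite (m : Measure ℝ) (y : ℝ) (h : Integrable (fun x => K (x - y)) m) :
    IsFiniteMeasure (wm m y) := by
  have := isFiniteMeasure_withDensity_ofReal h.2
  unfold wm
  infer_instance

lemma levy_conclusion (h : Hyp m H) (φ : BoundedContinuousFunction ℝ ℝ) :
    Tendsto (fun y => ∫ x, K (x - y) * φ (x - y) ∂m) atTop (𝓝 (∫ x, K x * φ x)) := by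
  rw [tendsto_iff_seq_tendsto]
  intro u hu
  have hK0 : Integrable (fun x => K (x - 0)) := by simpa using K_int
  let μ : ℕ → FiniteMeasure ℝ := fun n => ⟨wm m (u n), wm_finite m _ (K_integrable h _)⟩
  let μ0 : FiniteMeasure ℝ := ⟨wm volume 0, wm_finite _ _ hK0⟩
  have h0 : μ0 ≠ 0 := by
    intro h0
    have h1 : wm volume 0 = 0 := congrArg (fun ν : FiniteMeasure ℝ => (ν : Measure ℝ)) h0
    have h2 := wm_integral volume 0 (fun _ => (1:ℝ)) continuous_const
    rw [h1] at h2
    simp only [integral_zero_measure, sub_zero, smul_eq_mul, mul_one] at h2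
    have h3 := (integral_pos_iff_support_of_nonneg (fun x => (K_pos x).le) K_int).mpr (by
      have : Function.support K = univ := by ext x; simp [(K_pos x).ne']
      rw [this]; simp)
    linarith
  have hl := levy_finite μ μ0 h0 ?_
  · have := FiniteMeasure.tendsto_iff_forall_integral_tendsto.mp hl φ
    simp only [μ, μ0, FiniteMeasure.toMeasure_mk] at this
    simpa only [wm_integral _ _ _ φ.continuous, smul_eq_mul, sub_zero] using! this
  · intro t
    have h1 := (char_tendsto h t).comp hu
    simp only [μ, μ0, FiniteMeasure.toMeasure_mk, charFun_apply_real]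
    simp_rw [wm_integral _ _ (fun x : ℝ => Complex.exp (t * x * Complex.I)) (by fun_prop)]
    simpa [Function.comp_def, mul_comm] using! h1

/-- ramp -/
noncomputable def ramp (ε x : ℝ) : ℝ := max 0 (min 1 (1 - x / ε))

lemma smooth_tendsto (h : Hyp m H) {η ε : ℝ} (hη : 0 < η) (hε : 0 < ε) (hε1 : ε ≤ 1) :
    (∀ y, Integrable (fun x => Real.exp (η * (x - y)) * ramp ε (x - y)) m) ∧
    Tendsto (fun y => ∫ x, Real.exp (η * (x - y)) * ramp ε (x - y) ∂m) atTop
      (𝓝 (∫ x, Real.exp (η * x) * ramp ε x)) := by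
  obtain ⟨C, hC⟩ := exp_div_K_bound η hη
  have hcK := K_cont
  have hr1 : ∀ x, ramp ε x ≤ 1 := fun x => max_le zero_le_one (min_le_left _ _)
  have hr0 : ∀ x, 0 ≤ ramp ε x := fun x => le_max_left _ _
  have hrz : ∀ x, 1 < x → ramp ε x = 0 := by
    intro x hx
    refine max_eq_left ((min_le_right _ _).trans ?_)
    rw [sub_nonpos, one_le_div hε]
    linarith
  have hC0 : 0 ≤ C := (div_nonneg (Real.exp_pos _).le (K_pos 0).le).trans (hC 0 zero_le_one)
  have hcr : Continuous (ramp ε) := by unfold ramp; fun_prop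
  let φ : BoundedContinuousFunction ℝ ℝ := BoundedContinuousFunction.ofNormedAddCommGroup
    (fun x => Real.exp (η * x) * ramp ε x / K x)
    (Continuous.div (by fun_prop) hcK fun x => (K_pos x).ne') C (by
      intro x
      rw [Real.norm_of_nonneg (div_nonneg (mul_nonneg (Real.exp_pos _).le (hr0 x)) (K_pos x).le)]
      by_cases hx : 1 < x
      · simp [hrz x hx, hC0]
      · push Not at hx
        refine le_trans ?_ (hC x hx)
        have := K_pos x
        gcongr
        exact mul_le_of_le_one_right (Real.exp_pos _).le (hr1 x))
  have hφ : ∀ x, K x * φ x = Real.exp (η * x) * ramp ε x := by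
    intro x
    have := (K_pos x).ne'
    simp only [φ, BoundedContinuousFunction.coe_ofNormedAddCommGroup]
    field_simp
  have := levy_conclusion h φ
  simp only [hφ] at this
  refine ⟨fun y => ?_, this⟩
  simp_rw [← hφ]
  refine (K_integrable h y).mul_bdd (c := ‖φ‖) (Continuous.aestronglyMeasurable (by fun_prop)) ?_
  exact Eventually.of_forall fun x => φ.norm_coe_le_norm _

/-- Wiener-Ikehara, measure form. -/
theorem wiener_ikehara (h : Hyp m H) {η : ℝ} (hη : 0 < η) :
    Tendsto (fun y => ∫ x in Iic y, Real.exp (η * (x - y)) ∂m) atTop (𝓝 (1 / η)) := by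
  set u : ℝ → ℝ := fun y => ∫ x in Iic y, Real.exp (η * (x - y)) ∂m with hu
  have hr1 : ∀ ε x, ramp ε x ≤ 1 := fun ε x => max_le zero_le_one (min_le_left _ _)
  have hr0 : ∀ ε x, 0 ≤ ramp ε x := fun ε x => le_max_left _ _
  have hrz : ∀ ε x, 0 < ε → ε < x → ramp ε x = 0 := by
    intro ε x hε hx
    refine max_eq_left ((min_le_right _ _).trans ?_)
    rw [sub_nonpos, one_le_div hε]
    linarith
  have hro : ∀ ε x, 0 < ε → x ≤ 0 → ramp ε x = 1 := by
    intro ε x hε hx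
    have : x / ε ≤ 0 := div_nonpos_of_nonpos_of_nonneg hx hε.le
    unfold ramp
    rw [min_eq_left (by linarith), max_eq_right zero_le_one]
  -- pointwise bounds
  have lowpt : ∀ ε x, 0 < ε → (Iic 0).indicator (fun x => Real.exp (η * x)) x ≤
      Real.exp (η * x) * ramp ε x := by
    intro ε x hε
    by_cases hx : x ≤ 0
    · simp [hx, hro ε x hε hx]
    · simp only [indicator, mem_Iic, hx, if_false]
      exact mul_nonneg (Real.exp_pos _).le (hr0 _ _)
  have uppt : ∀ ε x, 0 < ε → Real.exp (η * x) * ramp ε x ≤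
      (Iic ε).indicator (fun x => Real.exp (η * x)) x := by
    intro ε x hε
    by_cases hx : x ≤ ε
    · simp only [indicator, mem_Iic, hx, if_true]
      exact mul_le_of_le_one_right (Real.exp_pos _).le (hr1 _ _)
    · simp [hx, hrz ε x hε (not_le.mp hx)]
  have hind : ∀ a y x : ℝ, (Iic a).indicator (fun x => Real.exp (η * x)) (x - y) =
      (Iic (y + a)).indicator (fun x => Real.exp (η * (x - y))) x := by
    intro a y x
    simp only [indicator, mem_Iic, sub_le_iff_le_add, add_comm]
  have hcont : ∀ y : ℝ, Continuous fun x : ℝ => Real.exp (η * (x - y)) := fun y => by fun_prop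
  have hii : ∀ y a : ℝ, Integrable ((Iic a).indicator fun x => Real.exp (η * (x - y))) m := by
    intro y a
    have h1 := (smooth_tendsto h hη one_pos le_rfl).1 a
    have h2 : Integrable ((Iic a).indicator fun x => Real.exp (η * (x - a))) m := by
      refine h1.mono' ((hcont a).aestronglyMeasurable.indicator measurableSet_Iic) ?_
      refine Eventually.of_forall fun x => ?_
      rw [Real.norm_of_nonneg (indicator_nonneg (fun _ _ => (Real.exp_pos _).le) _)]
      have := lowpt 1 (x - a) one_pos
      rwa [hind, add_zero] at this
    refine (h2.const_mul (Real.exp (η * (a - y)))).congr (Eventually.of_forall fun x => ?_)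
    simp only [indicator]
    split_ifs
    · rw [← Real.exp_add]; congr 1; ring
    · simp
  have hA : ∀ ε, 0 < ε → ε ≤ 1 → 1 / η ≤ ∫ x, Real.exp (η * x) * ramp ε x ∧
      ∫ x, Real.exp (η * x) * ramp ε x ≤ Real.exp (η * ε) / η := by
    intro ε hε hε1
    have hi : ∀ c : ℝ, Integrable ((Iic c).indicator fun x => Real.exp (η * x)) := fun c =>
      (integrable_indicator_iff measurableSet_Iic).mpr (integrableOn_exp_mul_Iic hη c)
    have hcr : Continuous (ramp ε) := by unfold ramp; fun_prop
    have hir : Integrable fun x => Real.exp (η * x) * ramp ε x := by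
      refine (hi ε).mono' (Continuous.aestronglyMeasurable (by fun_prop)) ?_
      refine Eventually.of_forall fun x => ?_
      rw [Real.norm_of_nonneg (mul_nonneg (Real.exp_pos _).le (hr0 _ _))]
      exact uppt ε x hε
    have hv : ∀ c : ℝ, ∫ x, (Iic c).indicator (fun x => Real.exp (η * x)) x
        = Real.exp (η * c) / η := by
      intro c
      rw [integral_indicator measurableSet_Iic, integral_exp_mul_Iic hη]
    constructor
    · have := integral_mono (hi 0) hir fun x => lowpt ε x hε
      rw [hv] at this
      simpa using this
    · have := integral_mono hir (hi ε) fun x => uppt ε x hε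
      rwa [hv] at this
  have hup : ∀ ε y, 0 < ε → ε ≤ 1 → u y ≤ ∫ x, Real.exp (η * (x - y)) * ramp ε (x - y) ∂m := by
    intro ε y hε hε1
    simp only [hu]
    rw [← integral_indicator measurableSet_Iic]
    refine integral_mono (hii y y) ((smooth_tendsto h hη hε hε1).1 y) fun x => ?_
    have := lowpt ε (x - y) hε
    rwa [hind, add_zero] at this
  have hlow : ∀ ε y, 0 < ε → ε ≤ 1 → Real.exp (-(η * ε)) *
      ∫ x, Real.exp (η * (x - (y - ε))) * ramp ε (x - (y - ε)) ∂m ≤ u y := by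
    intro ε y hε hε1
    simp only [hu]
    rw [← integral_indicator measurableSet_Iic, ← integral_const_mul]
    refine integral_mono (((smooth_tendsto h hη hε hε1).1 (y - ε)).const_mul _) (hii y y)
      fun x => ?_
    have := uppt ε (x - (y - ε)) hε
    rw [hind, sub_add_cancel] at this
    refine (mul_le_mul_of_nonneg_left this (Real.exp_pos _).le).trans (le_of_eq ?_)
    simp only [indicator]
    split_ifs
    · rw [← Real.exp_add]; congr 1; ring
    · simp
  -- conclusion
  have hlim1 : Tendsto (fun ε : ℝ => Real.exp (η * ε) / η) (𝓝[>] 0) (𝓝 (1 / η)) := by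
    have : Continuous fun ε : ℝ => Real.exp (η * ε) / η := by fun_prop
    have := this.tendsto 0
    simp only [mul_zero, Real.exp_zero] at this
    exact this.mono_left nhdsWithin_le_nhds
  have hlim2 : Tendsto (fun ε : ℝ => Real.exp (-(η * ε)) * (1 / η)) (𝓝[>] 0) (𝓝 (1 / η)) := by
    have : Continuous fun ε : ℝ => Real.exp (-(η * ε)) * (1 / η) := by fun_prop
    have := this.tendsto 0
    simp only [mul_zero, neg_zero, Real.exp_zero, one_mul] at this
    exact this.mono_left nhdsWithin_le_nhds
  have hsmall : ∀ᶠ ε : ℝ in 𝓝[>] 0, 0 < ε ∧ ε ≤ 1 := by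
    have := Ioc_mem_nhdsGT (zero_lt_one' ℝ)
    exact this
  rw [tendsto_order]
  constructor
  · intro a ha
    obtain ⟨ε, hε, hε0, hε1⟩ := ((hlim2.eventually_const_lt ha).and hsmall).exists
    have h1 := ((smooth_tendsto h hη hε0 hε1).2.comp
      (tendsto_atTop_add_const_right atTop (-ε) tendsto_id)).const_mul (Real.exp (-(η * ε)))
    have h2 : a < Real.exp (-(η * ε)) * ∫ x, Real.exp (η * x) * ramp ε x :=
      hε.trans_le (mul_le_mul_of_nonneg_left (hA ε hε0 hε1).1 (Real.exp_pos _).le)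
    filter_upwards [h1.eventually_const_lt h2] with y hy
    exact hy.trans_le (hlow ε y hε0 hε1)
  · intro a ha
    obtain ⟨ε, hε, hε0, hε1⟩ := ((hlim1.eventually_lt_const ha).and hsmall).exists
    have h1 := (smooth_tendsto h hη hε0 hε1).2
    filter_upwards [h1.eventually_lt_const ((hA ε hε0 hε1).2.trans_lt hε)] with y hy
    exact (hup ε y hε0 hε1).trans_lt hy

end WZ

namespace WZ

/-- atomic measure -/
noncomputable def atm {ι : Type*} (b x : ι → ℝ) : Measure ℝ :=
  Measure.sum fun p => ENNReal.ofReal (b p) • Measure.dirac (x p)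

lemma atm_sfinite {ι : Type*} [Countable ι] (b x : ι → ℝ) : SFinite (atm b x) := by
  have : ∀ p, SFinite (ENNReal.ofReal (b p) • Measure.dirac (x p)) := fun p => by
    rw [ENNReal.ofReal]; infer_instance
  unfold atm; infer_instance

lemma atm_integrable {ι : Type*} [Countable ι] {E : Type*} [NormedAddCommGroup E] [NormedSpace ℝ E]
    (b x : ι → ℝ) (hb : ∀ p, 0 ≤ b p) (F : ℝ → E) (h : Summable fun p => b p * ‖F (x p)‖) :
    Integrable F (atm b x) := by
  refine integrable_sum_measure (fun p => ?_) ?_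
  · exact (integrable_dirac (by simp)).smul_measure ENNReal.ofReal_ne_top
  · refine h.congr fun p => ?_
    rw [integral_smul_measure, integral_dirac, ENNReal.toReal_ofReal (hb p), smul_eq_mul]

lemma atm_integral {ι : Type*} [Countable ι] {E : Type*} [NormedAddCommGroup E] [NormedSpace ℝ E]
    [CompleteSpace E]
    (b x : ι → ℝ) (hb : ∀ p, 0 ≤ b p) (F : ℝ → E) (h : Summable fun p => b p * ‖F (x p)‖) :
    ∫ t, F t ∂(atm b x) = ∑' p, b p • F (x p) := by
  have := atm_integrable b x hb F h
  unfold atm at this ⊢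
  rw [integral_sum_measure this]
  congr 1; ext p
  rw [integral_smul_measure, integral_dirac, ENNReal.toReal_ofReal (hb p)]

lemma atm_nonneg {ι : Type*} [Countable ι] (b x : ι → ℝ) (hx : ∀ p, 0 ≤ x p) :
    ∀ᵐ t ∂(atm b x), 0 ≤ t := by
  unfold atm
  rw [Measure.ae_sum_iff]
  intro p
  refine Measure.ae_smul_measure ?_ _
  rw [ae_dirac_eq]
  exact hx p

section app
variable {L : Type*} (l w : L → ℝ)

noncomputable def xx (p : L × ℕ) : ℝ := ((p.2 : ℝ) + 1) * l p.1
noncomputable def aa (p : L × ℕ) : ℝ := l p.1 * w p.1 ^ (p.2 + 1)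

lemma aa_summable (hl : ∀ γ, 0 < l γ) (hw : ∀ γ, 0 ≤ w γ) (η : ℝ)
    (hconv : ∀ σ : ℝ, η < σ →
      Summable (fun p : L × ℕ =>
        w p.1 ^ (p.2 + 1) * Real.exp (-((p.2 : ℝ) + 1) * σ * l p.1) /
          ((p.2 : ℝ) + 1))) (σ : ℝ) (hσ : η < σ) :
    Summable fun p => aa l w p * Real.exp (-(σ * xx l p)) := by
  have h1 := hconv ((σ + η) / 2) (by linarith)
  have hc : 0 < (σ - η) / 2 := by linarith
  refine Summable.of_nonneg_of_le ?_ ?_ (h1.mul_left ((σ - η) / 2)⁻¹)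
  · intro p
    exact mul_nonneg (mul_nonneg (hl _).le (pow_nonneg (hw _) _)) (Real.exp_pos _).le
  · intro p
    have hk : (0:ℝ) < (p.2 : ℝ) + 1 := by positivity
    have hw' := pow_nonneg (hw p.1) (p.2 + 1)
    set c := (σ - η) / 2 with hcdef
    have he : Real.exp (-(σ * xx l p)) =
        Real.exp (-((p.2 : ℝ) + 1) * ((σ + η) / 2) * l p.1) * Real.exp (-(c * xx l p)) := by
      rw [← Real.exp_add]; congr 1; unfold xx; rw [hcdef]; ring
    have hu : c * xx l p * Real.exp (-(c * xx l p)) ≤ 1 := by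
      rw [Real.exp_neg, ← div_eq_mul_inv, div_le_one (Real.exp_pos _)]
      linarith [Real.add_one_le_exp (c * xx l p)]
    set E := Real.exp (-((p.2 : ℝ) + 1) * ((σ + η) / 2) * l p.1) with hE
    have hE0 : 0 < E := Real.exp_pos _
    rw [he]
    have : aa l w p * (E * Real.exp (-(c * xx l p))) =
        c⁻¹ * (w p.1 ^ (p.2 + 1) * E / ((p.2 : ℝ) + 1)) *
          (c * xx l p * Real.exp (-(c * xx l p))) := by
      unfold aa xx
      field_simp
    rw [this]
    exact mul_le_of_le_one_right (by positivity) hu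

lemma zetaLog_deriv (hl : ∀ γ, 0 < l γ) (hw : ∀ γ, 0 ≤ w γ) (η : ℝ)
    (hconv : ∀ σ : ℝ, η < σ →
      Summable (fun p : L × ℕ =>
        w p.1 ^ (p.2 + 1) * Real.exp (-((p.2 : ℝ) + 1) * σ * l p.1) /
          ((p.2 : ℝ) + 1))) (s : ℂ) (hs : η < s.re) :
    HasDerivAt (zetaLog l w) (-∑' p, (aa l w p : ℂ) * Complex.exp (-(s * xx l p))) s := by
  set σ := (s.re + η) / 2 with hσ
  have hσ1 : η < σ := by rw [hσ]; linarith
  have hσ2 : σ < s.re := by rw [hσ]; linarith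
  let F : L × ℕ → ℂ → ℂ := fun p s => (w p.1 : ℂ) ^ (p.2 + 1) *
    Complex.exp (-((p.2 : ℂ) + 1) * s * (l p.1 : ℂ)) / ((p.2 : ℂ) + 1)
  have hd : ∀ p (z : ℂ), HasDerivAt (F p) (-((aa l w p : ℂ) * Complex.exp (-(z * xx l p)))) z := by
    intro p z
    have hk : ((p.2 : ℂ) + 1) ≠ 0 := by exact_mod_cast p.2.succ_ne_zero
    have h1 : HasDerivAt (fun z : ℂ => -((p.2 : ℂ) + 1) * z * (l p.1 : ℂ))
        (-((p.2 : ℂ) + 1) * 1 * (l p.1 : ℂ)) z :=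
      ((hasDerivAt_id z).const_mul _).mul_const _
    have h2 := (h1.cexp.const_mul ((w p.1 : ℂ) ^ (p.2 + 1))).div_const ((p.2 : ℂ) + 1)
    convert! h2 using 1
    have : -(z * (xx l p : ℂ)) = -((p.2 : ℂ) + 1) * z * (l p.1 : ℂ) := by
      unfold xx; push_cast; ring
    rw [this]
    unfold aa
    push_cast
    field_simp
  have hU : IsOpen {z : ℂ | σ < z.re} := isOpen_lt continuous_const Complex.continuous_re
  have hF : ∀ p, DifferentiableOn ℂ (F p) {z : ℂ | σ < z.re} := fun p z _ =>
    (hd p z).differentiableAt.differentiableWithinAt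
  have hb : ∀ p (z : ℂ), z ∈ {z : ℂ | σ < z.re} → ‖F p z‖ ≤
      w p.1 ^ (p.2 + 1) * Real.exp (-((p.2 : ℝ) + 1) * σ * l p.1) / ((p.2 : ℝ) + 1) := by
    intro p z hz
    have hz' : σ < z.re := hz
    have hk : (0:ℝ) < (p.2 : ℝ) + 1 := by positivity
    have hkn : ‖((p.2 : ℂ) + 1)‖ = (p.2 : ℝ) + 1 := by
      have : ((p.2 : ℂ) + 1) = (((p.2 : ℝ) + 1 : ℝ) : ℂ) := by push_cast; rfl
      rw [this, Complex.norm_real, Real.norm_of_nonneg hk.le]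
    have hre : (-((p.2 : ℂ) + 1) * z * (l p.1 : ℂ)).re = -((p.2 : ℝ) + 1) * z.re * l p.1 := by
      simp
    simp only [F]
    rw [norm_div, norm_mul, norm_pow, hkn, Complex.norm_exp, hre, Complex.norm_real,
      Real.norm_of_nonneg (hw _)]
    have hw' := pow_nonneg (hw p.1) (p.2 + 1)
    refine div_le_div_of_nonneg_right (mul_le_mul_of_nonneg_left (Real.exp_le_exp.mpr ?_) hw') hk.le
    have := mul_le_mul_of_nonneg_left hz'.le (mul_pos hk (hl p.1)).le
    linarith
  have hD := (Complex.differentiableOn_tsum_of_summable_norm (hconv σ hσ1) hF hU hb).differentiableAt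
    (hU.mem_nhds hσ2)
  have hS := Complex.hasSum_deriv_of_summable_norm (hconv σ hσ1) hF hU hb hσ2
  have := hD.hasDerivAt
  rw [← hS.tsum_eq] at this
  simp_rw [fun p => (hd p s).deriv] at this
  rw [tsum_neg] at this
  exact this

end app
end WZ

open WZ

theorem weighted_zeta_chebyshev_asymptotics
    {L : Type*} [Countable L] (l : L → ℝ) (l₀ : ℝ) (hl₀ : 0 < l₀)
    (hl : ∀ γ, l₀ ≤ l γ) (w : L → ℝ) (hw : ∀ γ, 0 ≤ w γ) (η : ℝ) (hη : 0 < η)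
    (hconv : ∀ σ : ℝ, η < σ →
      Summable (fun p : L × ℕ =>
        w p.1 ^ (p.2 + 1) * Real.exp (-((p.2 : ℝ) + 1) * σ * l p.1) /
          ((p.2 : ℝ) + 1)))
    (hext : ∃ U : Set ℂ, IsOpen U ∧ {s : ℂ | η ≤ s.re} ⊆ U ∧
      ∃ g : ℂ → ℂ, AnalyticOnNhd ℂ g U ∧ (∀ s ∈ U, g s ≠ 0) ∧
        ∀ s ∈ U, η < s.re →
          Complex.exp (zetaLog l w s) = g s / (s - (η : ℂ))) :
    Filter.Tendsto
      (fun T : ℝ => Real.exp (-η * T) *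
        ∑' p : {p : L × ℕ // ((p.2 : ℝ) + 1) * l p.1 ≤ T},
          l p.1.1 * w p.1.1 ^ (p.1.2 + 1))
      Filter.atTop (nhds (1 / η)) := by
  have hlp : ∀ γ, 0 < l γ := fun γ => hl₀.trans_le (hl γ)
  obtain ⟨U, hUo, hUs, g, hg, hg0, hgZ⟩ := hext
  have hS := aa_summable l w hlp hw η hconv
  have ha0 : ∀ p, 0 ≤ aa l w p := fun p => mul_nonneg (hlp _).le (pow_nonneg (hw _) _)
  have hx0 : ∀ p, 0 ≤ xx l p := fun p => mul_nonneg (by positivity) (hlp _).le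
  let b : L × ℕ → ℝ := fun p => aa l w p * Real.exp (-(η * xx l p))
  have hb0 : ∀ p, 0 ≤ b p := fun p => mul_nonneg (ha0 p) (Real.exp_pos _).le
  have := atm_sfinite b (xx l)
  have hSb : ∀ δ, 0 < δ → Summable fun p => b p * Real.exp (-(δ * xx l p)) := by
    intro δ hδ
    refine (hS (η + δ) (by linarith)).congr fun p => ?_
    simp only [b]
    rw [mul_assoc, ← Real.exp_add]
    congr 2; ring
  -- logarithmic derivative
  have hPhi : ∀ s : ℂ, η < s.re → ∑' p, (aa l w p : ℂ) * Complex.exp (-(s * xx l p)) =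
      1 / (s - η) - deriv g s / g s := by
    intro s hs
    have hsU : s ∈ U := hUs hs.le
    have hne : s - (η : ℂ) ≠ 0 := by
      intro h0
      have := congrArg Complex.re h0
      simp at this
      linarith
    have h1 := (zetaLog_deriv l w hlp hw η hconv s hs).cexp
    have h2 : HasDerivAt (fun s => g s / (s - (η : ℂ)))
        ((deriv g s * (s - η) - g s * 1) / (s - η) ^ 2) s :=
      (hg s hsU).differentiableAt.hasDerivAt.div ((hasDerivAt_id s).sub_const _) hne
    have hev : (fun s => g s / (s - (η : ℂ))) =ᶠ[𝓝 s] fun s => Complex.exp (zetaLog l w s) := by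
      have ho : IsOpen {z : ℂ | η < z.re} := isOpen_lt continuous_const Complex.continuous_re
      filter_upwards [ho.mem_nhds hs] with z hz
      have hz' : η < z.re := hz
      exact (hgZ z (hUs hz'.le) hz).symm
    have h3 := (h1.congr_of_eventuallyEq hev).unique h2
    rw [hgZ s hsU hs] at h3
    have hgs := hg0 s hsU
    generalize (∑' p, (aa l w p : ℂ) * Complex.exp (-(s * xx l p))) = P at h3 ⊢
    field_simp at h3 ⊢
    linear_combination -h3
  let H : ℂ → ℂ := fun s => -(deriv g (s + η) / g (s + η))
  have hH : Hyp (atm b (xx l)) H := by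
    refine ⟨atm_nonneg b (xx l) hx0, ?_, ?_, ?_⟩
    · intro δ hδ
      refine atm_integrable b _ hb0 _ ((hSb δ hδ).congr fun p => ?_)
      rw [Real.norm_of_nonneg (Real.exp_pos _).le]
    · have hmaps : MapsTo (fun s : ℂ => s + (η : ℂ)) {s : ℂ | 0 ≤ s.re} U := by
        intro s hs
        apply hUs
        have : 0 ≤ s.re := hs
        simpa using this
      have hc : ContinuousOn (fun z => deriv g z / g z) U :=
        hg.deriv.continuousOn.div hg.continuousOn hg0
      exact (hc.comp (by fun_prop) hmaps).neg
    · intro s hs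
      rw [atm_integral b _ hb0]
      · have h1 := hPhi (s + η) (by simpa using hs)
        simp only [H]
        rw [add_sub_cancel_right] at h1
        rw [← sub_eq_add_neg, ← h1]
        congr 1; ext p
        simp only [b, Complex.real_smul]
        push_cast
        rw [mul_assoc, ← Complex.exp_add]
        congr 2; ring
      · refine (hSb s.re hs).congr fun p => ?_
        rw [Complex.norm_exp]
        simp
  refine (wiener_ikehara hH hη).congr fun T => ?_
  rw [← integral_indicator measurableSet_Iic, atm_integral b _ hb0]
  · have := tsum_subtype {p : L × ℕ | ((p.2 : ℝ) + 1) * l p.1 ≤ T}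
      (fun p => l p.1 * w p.1 ^ (p.2 + 1))
    refine Eq.trans ?_ (congrArg (fun z => Real.exp (-η * T) * z) this.symm)
    rw [← tsum_mul_left]
    congr 1; ext p
    simp only [indicator, mem_Iic, mem_ofPred_eq, xx, smul_eq_mul]
    split_ifs
    · simp only [b, xx, aa]
      rw [mul_assoc, ← Real.exp_add, mul_comm]
      congr 2; ring
    · simp
  · refine Summable.of_nonneg_of_le (fun p => mul_nonneg (hb0 p) (norm_nonneg _)) (fun p => ?_)
      ((hSb 1 one_pos).mul_left (Real.exp T))
    rw [mul_left_comm]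
    refine mul_le_mul_of_nonneg_left ?_ (hb0 p)
    rw [← Real.exp_add]
    simp only [indicator, mem_Iic]
    split_ifs with hT
    · rw [Real.norm_of_nonneg (Real.exp_pos _).le, Real.exp_le_exp]
      nlinarith
    · simp [(Real.exp_pos _).le]
end

section
/- Let L be a countable set, l : L → ℝ a function with l(γ) ≥ l₀ for all γ ∈ L for some constant l₀ > 0, w : L → [0,∞) a weight, and η > 0. Assume: (a) for every real σ > η the double series Σ_{γ∈L} Σ_{k≥1} w(γ)^k · e^{−k·σ·l(γ)}/k converges, so that Z(s) := exp( Σ_{γ∈L} Σ_{k≥1} w(γ)^k · e^{−k·s·l(γ)}/k ) is defined and analytic on {Re(s) > η}; and (b) there exist an open set U ⊆ ℂ containing the closed half-plane {s : Re(s) ≥ η} and an analytic function g on U with g(s) ≠ 0 for all s ∈ U, such that Z(s) = g(s)/(s−η) for every s ∈ U with Re(s) > η. Then Σ_{(γ,k) ∈ L×ℕ≥1 with k·l(γ) ≤ T} w(γ)^k ∼ e^{ηT}/(ηT) as T → ∞, i.e. the ratio of the two sides tends to 1. -/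
open MeasureTheory Filter Topology Set

noncomputable def fejK (u : ℝ) : ℝ := ∫ t in (-1:ℝ)..1, (1 - |t|) * Real.cos (t * u)

lemma fejK_cont : Continuous fejK := by
  unfold fejK
  apply intervalIntegral.continuous_parametric_intervalIntegral_of_continuous' 
  fun_prop

lemma fejK_sq (u : ℝ) : u ^ 2 * fejK u = 2 * (1 - Real.cos u) := by
  unfold fejK
  have hi : ∀ a b : ℝ, IntervalIntegrable (fun t : ℝ => (1 - |t|) * Real.cos (t * u)) volume a b :=
    fun a b => (by fun_prop : Continuous fun t : ℝ => (1 - |t|) * Real.cos (t * u)).intervalIntegrable a b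
  rw [← intervalIntegral.integral_add_adjacent_intervals (hi (-1) 0) (hi 0 1), mul_add,
    ← intervalIntegral.integral_const_mul, ← intervalIntegral.integral_const_mul]
  have h1 : ∫ t in (-1:ℝ)..0, u ^ 2 * ((1 - |t|) * Real.cos (t * u)) = 1 - Real.cos u := by
    have : ∫ t in (-1:ℝ)..0, u ^ 2 * ((1 - |t|) * Real.cos (t * u))
        = ∫ t in (-1:ℝ)..0, u ^ 2 * ((1 + t) * Real.cos (t * u)) := by
      apply intervalIntegral.integral_congr
      intro t ht
      rw [uIcc_of_le (by norm_num)] at ht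
      simp only [abs_of_nonpos ht.2]; ring
    rw [this, intervalIntegral.integral_eq_sub_of_hasDerivAt
      (f := fun t => (1 + t) * u * Real.sin (t * u) + Real.cos (t * u))]
    · simp
    · intro t _
      have e1 : HasDerivAt (fun t : ℝ => t * u) u t := by
        simpa using (hasDerivAt_id t).mul_const u
      have e2 : HasDerivAt (fun t : ℝ => (1 + t) * u) u t := by
        simpa using ((hasDerivAt_id t).const_add 1).mul_const u
      exact ((e2.mul e1.sin).add e1.cos).congr_deriv (by ring)
    · exact Continuous.intervalIntegrable (by fun_prop) _ _
  have h2 : ∫ t in (0:ℝ)..1, u ^ 2 * ((1 - |t|) * Real.cos (t * u)) = 1 - Real.cos u := by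
    have : ∫ t in (0:ℝ)..1, u ^ 2 * ((1 - |t|) * Real.cos (t * u))
        = ∫ t in (0:ℝ)..1, u ^ 2 * ((1 - t) * Real.cos (t * u)) := by
      apply intervalIntegral.integral_congr
      intro t ht
      rw [uIcc_of_le (by norm_num)] at ht
      simp only [abs_of_nonneg ht.1]
    rw [this, intervalIntegral.integral_eq_sub_of_hasDerivAt
      (f := fun t => (1 - t) * u * Real.sin (t * u) - Real.cos (t * u))]
    · simp; ring
    · intro t _
      have e1 : HasDerivAt (fun t : ℝ => t * u) u t := by
        simpa using (hasDerivAt_id t).mul_const u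
      have e2 : HasDerivAt (fun t : ℝ => (1 - t) * u) (-u) t := by
        simpa using ((hasDerivAt_id t).const_sub 1).mul_const u
      exact ((e2.mul e1.sin).sub e1.cos).congr_deriv (by ring)
    · exact Continuous.intervalIntegrable (by fun_prop) _ _
  rw [h1, h2]; ring

lemma fejK_zero : 0 < fejK 0 := by
  unfold fejK
  simp only [mul_zero, Real.cos_zero, mul_one]
  apply intervalIntegral.intervalIntegral_pos_of_pos_on
  · exact Continuous.intervalIntegrable (by fun_prop) _ _
  · intro t ht
    have := abs_lt.mpr ht
    linarith
  · norm_num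

lemma fejK_nonneg (u : ℝ) : 0 ≤ fejK u := by
  rcases eq_or_ne u 0 with rfl | h
  · exact fejK_zero.le
  · have h1 := fejK_sq u
    have h2 := Real.cos_le_one u
    have h3 : 0 < u ^ 2 := by positivity
    by_contra! h4
    nlinarith

lemma fejK_le_two (u : ℝ) : fejK u ≤ 2 := by
  have : ‖fejK u‖ ≤ 1 * |1 - (-1:ℝ)| := by
    unfold fejK
    apply intervalIntegral.norm_integral_le_of_norm_le_const
    intro t ht
    rw [uIoc_of_le (by norm_num)] at ht
    have h1 : |t| ≤ 1 := abs_le.mpr ⟨ht.1.le, ht.2⟩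
    rw [norm_mul, Real.norm_eq_abs, Real.norm_eq_abs, abs_of_nonneg (by linarith)]
    have := Real.abs_cos_le_one (t * u)
    have := abs_nonneg t
    have := abs_nonneg (Real.cos (t * u))
    nlinarith
  have h2 := Real.le_norm_self (fejK u)
  norm_num at this h2
  linarith

lemma fejK_integrable : Integrable fejK := by
  have h := integrable_inv_one_add_sq.const_mul 6
  refine h.mono' fejK_cont.aestronglyMeasurable (ae_of_all _ fun u => ?_)
  rw [Real.norm_of_nonneg (fejK_nonneg u), ← div_eq_mul_inv, le_div_iff₀ (by positivity)]
  have h1 := fejK_sq u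
  have h2 := Real.neg_one_le_cos u
  have h3 := fejK_le_two u
  nlinarith

lemma fejK_integral_pos : 0 < ∫ u, fejK u := by
  rw [integral_pos_iff_support_of_nonneg fejK_nonneg fejK_integrable]
  exact fejK_cont.isOpen_support.measure_pos _ ⟨0, fejK_zero.ne'⟩

lemma fejK_complex (v : ℝ) :
    ((fejK v : ℝ) : ℂ) = ∫ t in (-1:ℝ)..1, ((1 - |t| : ℝ) : ℂ) * Complex.exp (-Complex.I * t * v) := by
  have hodd : ∫ t in (-1:ℝ)..1, (1 - |t|) * Real.sin (t * v) = 0 := by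
    have := intervalIntegral.integral_comp_neg (a := (-1:ℝ)) (b := 1) (fun t : ℝ => (1 - |t|) * Real.sin (t * v))
    simp only [abs_neg, neg_mul, Real.sin_neg, mul_neg, neg_neg, intervalIntegral.integral_neg] at this
    linarith
  have : ∀ t : ℝ, ((1 - |t| : ℝ) : ℂ) * Complex.exp (-Complex.I * t * v)
      = (((1 - |t|) * Real.cos (t * v) : ℝ) : ℂ) - Complex.I * (((1 - |t|) * Real.sin (t * v) : ℝ) : ℂ) := by
    intro t
    have : -Complex.I * t * v = ((-(t * v) : ℝ) : ℂ) * Complex.I := by push_cast; ring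
    rw [this, Complex.exp_mul_I, ← Complex.ofReal_cos, ← Complex.ofReal_sin, Real.cos_neg, Real.sin_neg]
    push_cast; ring
  simp_rw [this]
  rw [intervalIntegral.integral_sub, intervalIntegral.integral_const_mul, intervalIntegral.integral_ofReal,
    intervalIntegral.integral_ofReal, hodd]
  · simp [fejK]
  · exact Continuous.intervalIntegrable (by fun_prop) _ _
  · exact Continuous.intervalIntegrable (by fun_prop) _ _

open MeasureTheory Filter Topology Set

lemma wi_identity (f : ℝ → ℝ) (ε R x : ℝ) (hf : Integrable (fun u => f u * Real.exp (-ε * u))) :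
    ((∫ u, f u * Real.exp (-ε * u) * fejK (R * (u - x)) : ℝ) : ℂ) =
      ∫ t in (-1:ℝ)..1, ((1 - |t| : ℝ) : ℂ) * Complex.exp (Complex.I * t * R * x) *
        ∫ u : ℝ, (f u : ℂ) * Complex.exp (-((ε : ℂ) + Complex.I * t * R) * u) := by
  rw [← integral_complex_ofReal]
  have h1 : ∀ u : ℝ, (((f u * Real.exp (-ε * u) * fejK (R * (u - x)) : ℝ)) : ℂ) =
      ∫ t in (-1:ℝ)..1, ((f u * Real.exp (-ε * u) : ℝ) : ℂ) *
        (((1 - |t| : ℝ) : ℂ) * Complex.exp (-Complex.I * t * (R * (u - x) : ℝ))) := by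
    intro u
    rw [intervalIntegral.integral_const_mul, ← fejK_complex]
    push_cast; ring
  have h2 : ∀ t u : ℝ, ((f u * Real.exp (-ε * u) : ℝ) : ℂ) *
        (((1 - |t| : ℝ) : ℂ) * Complex.exp (-Complex.I * t * (R * (u - x) : ℝ)))
      = ((1 - |t| : ℝ) : ℂ) * Complex.exp (Complex.I * t * R * x) *
       ((f u : ℂ) * Complex.exp (-((ε : ℂ) + Complex.I * t * R) * u)) := by
    intro t u
    have e : Complex.exp (-((ε : ℂ) + Complex.I * t * R) * u) * Complex.exp (Complex.I * t * R * x)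
        = Complex.exp (-ε * u) * Complex.exp (-Complex.I * t * (R * (u - x) : ℝ)) := by
      rw [← Complex.exp_add, ← Complex.exp_add]
      congr 1
      push_cast; ring
    push_cast at e ⊢
    linear_combination (-(f u : ℂ) * (1 - ((|t| : ℝ) : ℂ))) * e
  simp_rw [← integral_const_mul, ← h2]
  rw [intervalIntegral_integral_swap]
  · exact integral_congr_ae (ae_of_all _ h1)
  · have hk : Integrable (fun t : ℝ => ((1 - |t| : ℝ) : ℂ)) (volume.restrict (uIoc (-1) 1)) :=
      (intervalIntegrable_iff.mp ((by fun_prop : Continuous (fun t : ℝ => ((1 - |t| : ℝ) : ℂ))).intervalIntegrable (-1) 1))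
    have hp : Integrable (fun z : ℝ × ℝ => ((1 - |z.1| : ℝ) : ℂ) * ((f z.2 * Real.exp (-ε * z.2) : ℝ) : ℂ))
        ((volume.restrict (uIoc (-1) 1)).prod volume) := hk.mul_prod (hf.ofReal (𝕜 := ℂ))
    have hc : Continuous (fun z : ℝ × ℝ => Complex.exp (-Complex.I * z.1 * (R * (z.2 - x) : ℝ))) := by
      fun_prop
    refine (hp.mono (hp.aestronglyMeasurable.mul hc.aestronglyMeasurable) (ae_of_all _ fun z => ?_)).congr
      (ae_of_all _ fun z => ?_)
    · have : ‖Complex.exp (-Complex.I * z.1 * (R * (z.2 - x) : ℝ))‖ = 1 := by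
        rw [Complex.norm_exp]
        simp
      simp only [Pi.mul_apply]
      rw [norm_mul, this, mul_one]
    · simp only [Pi.mul_apply, Function.uncurry]
      push_cast; ring

/-- Limit as `ε → 0`. -/
lemma wi_eps_limit (Φ : ℂ → ℂ) (hΦ : ContinuousOn Φ {z | 0 ≤ z.re}) (R x : ℝ) :
    Tendsto (fun ε : ℝ => ∫ t in (-1:ℝ)..1, ((1 - |t| : ℝ) : ℂ) * Complex.exp (Complex.I * t * R * x) *
        Φ ((ε : ℂ) + Complex.I * t * R)) (𝓝[>] 0)
      (𝓝 (∫ t in (-1:ℝ)..1, ((1 - |t| : ℝ) : ℂ) * Complex.exp (Complex.I * t * R * x) *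
        Φ (Complex.I * t * R))) := by
  -- replace `ε` by `max ε 0`
  have hc : Continuous (fun p : ℝ × ℝ => Φ (((max p.1 0 : ℝ) : ℂ) + Complex.I * p.2 * R)) := by
    apply hΦ.comp_continuous (by fun_prop)
    intro p; simp
  have hc2 : Continuous (fun ε : ℝ => ∫ t in (-1:ℝ)..1, ((1 - |t| : ℝ) : ℂ) * Complex.exp (Complex.I * t * R * x) *
        Φ (((max ε 0 : ℝ) : ℂ) + Complex.I * t * R)) := by
    apply intervalIntegral.continuous_parametric_intervalIntegral_of_continuous'
    exact (by fun_prop : Continuous fun p : ℝ × ℝ => ((1 - |p.2| : ℝ) : ℂ) * Complex.exp (Complex.I * p.2 * R * x)).mul hc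
  have := (hc2.tendsto 0).mono_left (nhdsWithin_le_nhds (s := Ioi 0))
  simp only [max_self, Complex.ofReal_zero, zero_add] at this
  refine this.congr' ?_
  filter_upwards [self_mem_nhdsWithin] with ε hε
  rw [max_eq_left (le_of_lt hε)]

lemma wi_bound (Φ : ℂ → ℂ) (hΦ : ContinuousOn Φ {z | 0 ≤ z.re}) (R : ℝ) :
    ∃ C, ∀ ε x : ℝ, 0 < ε → ε ≤ 1 → ‖∫ t in (-1:ℝ)..1, ((1 - |t| : ℝ) : ℂ) * Complex.exp (Complex.I * t * R * x) *
        Φ ((ε : ℂ) + Complex.I * t * R)‖ ≤ C := by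
  have hc : Continuous (fun p : ℝ × ℝ => Φ (((max p.1 0 : ℝ) : ℂ) + Complex.I * p.2 * R)) := by
    apply hΦ.comp_continuous (by fun_prop)
    intro p; simp
  obtain ⟨C, hC⟩ := ((isCompact_Icc (a := (0:ℝ)) (b := 1)).prod (isCompact_Icc (a := (-1:ℝ)) (b := 1))).exists_bound_of_continuousOn hc.continuousOn
  refine ⟨C * |1 - (-1)|, fun ε x h0 h1 => ?_⟩
  apply intervalIntegral.norm_integral_le_of_norm_le_const
  intro t ht
  rw [uIoc_of_le (by norm_num)] at ht
  have := hC (ε, t) ⟨⟨h0.le, h1⟩, ⟨ht.1.le, ht.2⟩⟩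
  simp only [max_eq_left h0.le] at this
  have h3 : ‖Complex.exp (Complex.I * t * R * x)‖ = 1 := by
    rw [Complex.norm_exp]; simp
  have h4 : |t| ≤ 1 := abs_le.mpr ⟨ht.1.le, ht.2⟩
  rw [norm_mul, norm_mul, h3, mul_one, Complex.norm_real, Real.norm_of_nonneg (by linarith)]
  have := norm_nonneg (Φ (↑ε + Complex.I * ↑t * ↑R))
  have := abs_nonneg t
  nlinarith

lemma wi_RL (Φ : ℂ → ℂ) (R : ℝ) (hR : 0 < R) :
    Tendsto (fun x : ℝ => ∫ t in (-1:ℝ)..1, ((1 - |t| : ℝ) : ℂ) * Complex.exp (Complex.I * t * R * x) *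
        Φ (Complex.I * t * R)) atTop (𝓝 0) := by
  have h := Real.tendsto_integral_exp_smul_cocompact
    ((Ioc (-1:ℝ) 1).indicator (fun t : ℝ => ((1 - |t| : ℝ) : ℂ) * Φ (Complex.I * t * R)))
  have h2 : Tendsto (fun x : ℝ => x * (-(R / (2 * Real.pi)))) atTop (cocompact ℝ) := by
    refine Tendsto.mono_right ?_ atBot_le_cocompact
    exact tendsto_id.atTop_mul_const_of_neg (by have := Real.pi_pos; simp; positivity)
  refine (h.comp h2).congr fun x => ?_
  simp only [Function.comp]
  rw [intervalIntegral.integral_of_le (by norm_num), ← integral_indicator measurableSet_Ioc]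
  congr 1
  ext t
  by_cases ht : t ∈ Ioc (-1:ℝ) 1
  · simp only [indicator_of_mem ht]
    rw [Circle.smul_def, Real.fourierChar_apply, smul_eq_mul]
    have : ((2 * Real.pi * -(t * (x * -(R / (2 * Real.pi)))) : ℝ) : ℂ) * Complex.I = Complex.I * t * R * x := by
      have : (2 * Real.pi * -(t * (x * -(R / (2 * Real.pi)))) : ℝ) = t * R * x := by
        field_simp
      rw [this]; push_cast; ring
    rw [this]; ring
  · simp [indicator_of_notMem ht]

open MeasureTheory Filter Topology Set

lemma wi_subst (h : ℝ → ℝ) (R x : ℝ) (hR : 0 < R) :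
    ∫ u, h u * fejK (R * (u - x)) = R⁻¹ * ∫ v, h (x + v / R) * fejK v := by
  have h1 := Measure.integral_comp_mul_left (fun v : ℝ => h (x + v / R) * fejK v) R
  have h2 := integral_sub_right_eq_self (fun u : ℝ => h (x + (R * u) / R) * fejK (R * u)) x (μ := volume)
  rw [abs_of_pos (inv_pos.mpr hR), smul_eq_mul] at h1
  rw [← h1, ← h2]
  congr 1; ext u
  congr 2
  field_simp; ring

lemma fejK_comp_integrable (R x : ℝ) (hR : 0 < R) : Integrable (fun u => fejK (R * (u - x))) :=
  (fejK_integrable.comp_mul_left' hR.ne').comp_sub_right x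

lemma wi_dct (h : ℝ → ℝ) (M R x : ℝ) (hR : 0 < R) (hm : Measurable h) (h0 : ∀ u, 0 ≤ h u) (hM : ∀ u, h u ≤ M)
    (hneg : ∀ u ≤ 0, h u = 0) :
    Tendsto (fun ε : ℝ => ∫ u, h u * Real.exp (-ε * u) * fejK (R * (u - x))) (𝓝[>] 0)
      (𝓝 (∫ u, h u * fejK (R * (u - x)))) := by
  apply tendsto_integral_filter_of_dominated_convergence (fun u => M * fejK (R * (u - x)))
  · refine Eventually.of_forall fun ε => ?_
    refine Measurable.aestronglyMeasurable ?_
    exact (hm.mul (by fun_prop)).mul (fejK_cont.measurable.comp (by fun_prop))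
  · filter_upwards [self_mem_nhdsWithin] with ε hε
    refine ae_of_all _ fun u => ?_
    have hK := fejK_nonneg (R * (u - x))
    rw [Real.norm_of_nonneg (by have := h0 u; positivity)]
    gcongr
    rcases le_or_gt u 0 with hu | hu
    · rw [hneg u hu, zero_mul]; exact (h0 u).trans (hM u)
    · have : Real.exp (-ε * u) ≤ 1 := by
        rw [Real.exp_le_one_iff]
        have : 0 < ε * u := mul_pos hε hu
        linarith
      nlinarith [h0 u, hM u, Real.exp_pos (-ε * u)]
  · exact (fejK_comp_integrable R x hR).const_mul M
  · refine ae_of_all _ fun u => ?_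
    have : Continuous (fun ε : ℝ => h u * Real.exp (-ε * u) * fejK (R * (u - x))) := by fun_prop
    have := (this.tendsto 0).mono_left (nhdsWithin_le_nhds (s := Ioi 0))
    simpa using this

noncomputable def stepf : ℝ → ℝ := (Ioi (0:ℝ)).indicator 1

lemma stepf_meas : Measurable stepf := measurable_one.indicator measurableSet_Ioi
lemma stepf_nonneg (u : ℝ) : 0 ≤ stepf u := indicator_nonneg (by simp) u
lemma stepf_le (u : ℝ) : stepf u ≤ 1 := indicator_le_self' (by simp) u |>.trans (by simp)
lemma stepf_neg (u : ℝ) (h : u ≤ 0) : stepf u = 0 := indicator_of_notMem (by simpa using h) _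
lemma stepf_pos (u : ℝ) (h : 0 < u) : stepf u = 1 := by
  simp [stepf, indicator_of_mem (show u ∈ Ioi (0:ℝ) from h)]

lemma stepf_int (ε : ℝ) (hε : 0 < ε) : Integrable (fun u => stepf u * Real.exp (-ε * u)) := by
  have : IntegrableOn (fun u : ℝ => Real.exp (-ε * u)) (Ioi 0) := integrableOn_exp_mul_Ioi (by linarith) 0
  rw [← integrable_indicator_iff measurableSet_Ioi] at this
  refine this.congr (ae_of_all _ fun u => ?_)
  by_cases h : 0 < u
  · simp [stepf_pos u h, indicator_of_mem (show u ∈ Ioi (0:ℝ) from h)]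
  · simp [stepf_neg u (not_lt.mp h), indicator_of_notMem (show u ∉ Ioi (0:ℝ) from h)]

lemma stepf_laplace (z : ℂ) (hz : 0 < z.re) : ∫ u : ℝ, (stepf u : ℂ) * Complex.exp (-z * u) = 1 / z := by
  have := integral_exp_mul_complex_Ioi (a := -z) (by simpa using hz) 0
  rw [← integral_indicator measurableSet_Ioi] at this
  have h0 : z ≠ 0 := by rintro rfl; simp at hz
  have e : -Complex.exp (-z * ((0:ℝ):ℂ)) / -z = 1 / z := by simp
  rw [e] at this
  rw [← this]
  congr 1; ext u
  by_cases h : 0 < u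
  · simp [stepf_pos u h, indicator_of_mem (show u ∈ Ioi (0:ℝ) from h)]
  · simp [stepf_neg u (not_lt.mp h), indicator_of_notMem (show u ∉ Ioi (0:ℝ) from h)]

lemma wi_mul_int (h : ℝ → ℝ) (R x : ℝ) (hh : Integrable h) :
    Integrable (fun u => h u * fejK (R * (u - x))) := by
  refine hh.mul_bdd (c := 2) ?_ (ae_of_all _ fun u => ?_)
  · exact (fejK_cont.comp (by fun_prop : Continuous fun u : ℝ => R * (u - x))).aestronglyMeasurable
  · rw [Real.norm_of_nonneg (fejK_nonneg _)]; exact fejK_le_two _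

noncomputable def wiE (Φ : ℂ → ℂ) (R ε x : ℝ) : ℂ :=
  ∫ t in (-1:ℝ)..1, ((1 - |t| : ℝ) : ℂ) * Complex.exp (Complex.I * t * R * x) *
        Φ ((ε : ℂ) + Complex.I * t * R)

lemma wi_S1 (α : ℝ) (H : ℝ → ℝ) (Φ : ℂ → ℂ) 
    (hIntg : ∀ ε : ℝ, 0 < ε → Integrable (fun u => H u * Real.exp (-ε * u)))
    (hL : ∀ z : ℂ, 0 < z.re → ∫ u : ℝ, (H u : ℂ) * Complex.exp (-z * u) = α / z + Φ z)
    (R ε x : ℝ) (hε : 0 < ε) :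
    ∫ u, H u * Real.exp (-ε * u) * fejK (R * (u - x)) =
      α * (∫ u, stepf u * Real.exp (-ε * u) * fejK (R * (u - x))) + (wiE Φ R ε x).re := by
  have hf : Integrable (fun u => (H u - α * stepf u) * Real.exp (-ε * u)) := by
    refine ((hIntg ε hε).sub ((stepf_int ε hε).const_mul α)).congr (ae_of_all _ fun u => ?_)
    simp only [Pi.sub_apply]; ring
  have h1 := wi_identity _ ε R x hf
  have hcplx : ∀ (h : ℝ → ℝ) (z : ℂ), z.re = ε → Integrable (fun u => h u * Real.exp (-ε * u)) →
      Integrable (fun u : ℝ => (h u : ℂ) * Complex.exp (-z * u)) := by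
    intro h z hz hh
    have hb : Continuous (fun u : ℝ => Complex.exp (-(z - ε) * u)) := by fun_prop
    refine ((hh.ofReal (𝕜 := ℂ)).mul_bdd (c := 1) hb.aestronglyMeasurable (ae_of_all _ fun u => ?_)).congr
      (ae_of_all _ fun u => ?_)
    · rw [Complex.norm_exp]; simp [hz]
    · simp only [Complex.coe_algebraMap, Complex.ofReal_mul, Complex.ofReal_exp]
      rw [mul_assoc, ← Complex.exp_add]
      congr 2
      push_cast; ring
  have h2 : ∀ t : ℝ, ∫ u : ℝ, ((H u - α * stepf u : ℝ) : ℂ) * Complex.exp (-((ε : ℂ) + Complex.I * t * R) * u)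
      = Φ ((ε : ℂ) + Complex.I * t * R) := by
    intro t
    set z := (ε : ℂ) + Complex.I * t * R with hz
    have hzr : z.re = ε := by simp [hz]
    have e : ∀ u : ℝ, ((H u - α * stepf u : ℝ) : ℂ) * Complex.exp (-z * u) =
      (H u : ℂ) * Complex.exp (-z * u) - α * ((stepf u : ℂ) * Complex.exp (-z * u)) := by
      intro u; push_cast; ring
    simp_rw [e]
    rw [integral_sub (hcplx H z hzr (hIntg ε hε)) ((hcplx stepf z hzr (stepf_int ε hε)).const_mul _),
      integral_const_mul, stepf_laplace z (by rw [hzr]; exact hε), hL z (by rw [hzr]; exact hε)]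
    ring
  simp_rw [h2] at h1
  have h3 : ∫ u, (H u - α * stepf u) * Real.exp (-ε * u) * fejK (R * (u - x)) = (wiE Φ R ε x).re := by
    unfold wiE
    rw [← h1, Complex.ofReal_re]
  have e : ∀ u : ℝ, (H u - α * stepf u) * Real.exp (-ε * u) * fejK (R * (u - x)) =
    H u * Real.exp (-ε * u) * fejK (R * (u - x)) - α * (stepf u * Real.exp (-ε * u) * fejK (R * (u - x))) := by
      intro u; ring
  simp_rw [e] at h3
  rw [integral_sub (wi_mul_int _ R x (hIntg ε hε)) ((wi_mul_int _ R x (stepf_int ε hε)).const_mul _),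
    integral_const_mul] at h3
  linarith

lemma wi_bounded (η α : ℝ) (hη : 0 ≤ η) (hα : 0 ≤ α) (H : ℝ → ℝ) (hH0 : ∀ u, 0 ≤ H u)
    (hneg : ∀ u ≤ 0, H u = 0)
    (hmono : ∀ u v, u ≤ v → H u ≤ Real.exp (η * (v - u)) * H v)
    (Φ : ℂ → ℂ) (hΦ : ContinuousOn Φ {z | 0 ≤ z.re})
    (hIntg : ∀ ε : ℝ, 0 < ε → Integrable (fun u => H u * Real.exp (-ε * u)))
    (hL : ∀ z : ℂ, 0 < z.re → ∫ u : ℝ, (H u : ℂ) * Complex.exp (-z * u) = α / z + Φ z) :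
    ∃ M, ∀ x, H x ≤ M := by
  obtain ⟨C, hC⟩ := wi_bound Φ hΦ 1
  have hk1 : 0 < ∫ v in (0:ℝ)..1, fejK v := by
    apply intervalIntegral.integral_pos (by norm_num) fejK_cont.continuousOn (fun v _ => fejK_nonneg v)
    exact ⟨0, by simp, fejK_zero⟩
  set k := ∫ v in (0:ℝ)..1, fejK v with hk
  have hCn : 0 ≤ C := (norm_nonneg _).trans (hC 1 0 one_pos le_rfl)
  have hκ := fejK_integral_pos
  refine ⟨Real.exp (η + 1) * ((α * (∫ v, fejK v) + C) / k), fun x => ?_⟩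
  rcases le_or_gt x 0 with hx | hx
  · rw [hneg x hx]; positivity
  set ε : ℝ := 1 / (x + 1) with hε
  have hε0 : 0 < ε := by positivity
  have hε1 : ε ≤ 1 := by rw [hε, div_le_one (by linarith)]; linarith
  have h1 := wi_S1 α H Φ hIntg hL 1 ε x hε0
  have h2 : (wiE Φ 1 ε x).re ≤ C := (Complex.re_le_norm _).trans (hC ε x hε0 hε1)
  have h3 : ∫ u, stepf u * Real.exp (-ε * u) * fejK (1 * (u - x)) ≤ ∫ v, fejK v := by
    rw [← integral_sub_right_eq_self fejK x]
    apply integral_mono (wi_mul_int _ 1 x (stepf_int ε hε0)) (fejK_integrable.comp_sub_right x)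
    intro u
    simp only [one_mul]
    have hK := fejK_nonneg (u - x)
    have : stepf u * Real.exp (-ε * u) ≤ 1 := by
      rcases le_or_gt u 0 with hu | hu
      · rw [stepf_neg u hu]; simp
      · rw [stepf_pos u hu, one_mul, Real.exp_le_one_iff]
        have : 0 < ε * u := mul_pos hε0 hu
        linarith
    nlinarith
  have h4 : Real.exp (-(η + 1)) * H x * k ≤ ∫ u, H u * Real.exp (-ε * u) * fejK (1 * (u - x)) := by
    have hi := wi_mul_int _ 1 x (hIntg ε hε0)
    calc Real.exp (-(η + 1)) * H x * k = ∫ u in Ioc x (x+1), Real.exp (-(η + 1)) * H x * fejK (u - x) := by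
          rw [← intervalIntegral.integral_of_le (by linarith), intervalIntegral.integral_const_mul,
            intervalIntegral.integral_comp_sub_right, hk]
          simp
      _ ≤ ∫ u in Ioc x (x+1), H u * Real.exp (-ε * u) * fejK (1 * (u - x)) := by
          apply setIntegral_mono_on _ hi.integrableOn measurableSet_Ioc
          · intro u hu
            rw [one_mul]
            apply mul_le_mul_of_nonneg_right _ (fejK_nonneg _)
            have e1 := hmono x u hu.1.le
            have e2 : Real.exp (η * (u - x)) ≤ Real.exp η := by
              apply Real.exp_le_exp.mpr; nlinarith [hu.1, hu.2]
            have e3 : Real.exp (-1) ≤ Real.exp (-ε * u) := by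
              apply Real.exp_le_exp.mpr
              have : ε * u ≤ 1 := by
                rw [hε, div_mul_eq_mul_div, one_mul, div_le_one (by linarith)]; exact hu.2
              linarith
            have e4 : H x ≤ Real.exp η * H u := e1.trans (mul_le_mul_of_nonneg_right e2 (hH0 u))
            calc Real.exp (-(η + 1)) * H x ≤ Real.exp (-(η + 1)) * (Real.exp η * H u) := by gcongr
              _ = H u * Real.exp (-1) := by
                  rw [← mul_assoc, ← Real.exp_add, mul_comm]; congr 2; ring
              _ ≤ _ := by have := hH0 u; gcongr
          · exact ((fejK_integrable.comp_sub_right x).const_mul _).integrableOn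
      _ ≤ _ := setIntegral_le_integral hi (ae_of_all _ fun u => by
            have := hH0 u; have := fejK_nonneg (1 * (u - x)); simp only [Pi.zero_apply]; positivity)
  have h5 : Real.exp (-(η + 1)) * H x * k ≤ α * (∫ v, fejK v) + C := by nlinarith
  have h6 : Real.exp (-(η + 1)) * H x ≤ (α * (∫ v, fejK v) + C) / k := by rwa [le_div_iff₀ hk1]
  calc H x = Real.exp (η + 1) * (Real.exp (-(η + 1)) * H x) := by
        rw [← mul_assoc, ← Real.exp_add]; simp
    _ ≤ _ := by gcongr

lemma wi_J (η α : ℝ) (hη : 0 ≤ η) (hα : 0 ≤ α) (H : ℝ → ℝ) (hH0 : ∀ u, 0 ≤ H u)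
    (hneg : ∀ u ≤ 0, H u = 0) (hm : Measurable H)
    (hmono : ∀ u v, u ≤ v → H u ≤ Real.exp (η * (v - u)) * H v)
    (Φ : ℂ → ℂ) (hΦ : ContinuousOn Φ {z | 0 ≤ z.re})
    (hIntg : ∀ ε : ℝ, 0 < ε → Integrable (fun u => H u * Real.exp (-ε * u)))
    (hL : ∀ z : ℂ, 0 < z.re → ∫ u : ℝ, (H u : ℂ) * Complex.exp (-z * u) = α / z + Φ z)
    (R : ℝ) (hR : 0 < R) :
    Tendsto (fun x => ∫ v, H (x + v / R) * fejK v) atTop (𝓝 (α * ∫ v, fejK v)) := by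
  obtain ⟨M, hM⟩ := wi_bounded η α hη hα H hH0 hneg hmono Φ hΦ hIntg hL
  have h1 : ∀ x, ∫ v, H (x + v / R) * fejK v = α * (∫ v, stepf (x + v / R) * fejK v) + R * (wiE Φ R 0 x).re := by
    intro x
    have a1 := wi_dct H M R x hR hm hH0 hM hneg
    have a2 := (wi_dct stepf 1 R x hR stepf_meas stepf_nonneg stepf_le stepf_neg).const_mul α
    have a3 : Tendsto (fun ε => (wiE Φ R ε x).re) (𝓝[>] 0) (𝓝 (wiE Φ R 0 x).re) := by
      have := wi_eps_limit Φ hΦ R x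
      refine (Complex.continuous_re.tendsto _).comp ?_
      simpa [wiE] using this
    have a4 := a2.add a3
    have a5 := tendsto_nhds_unique a1 (a4.congr' (by
      filter_upwards [self_mem_nhdsWithin] with ε hε
      exact (wi_S1 α H Φ hIntg hL R ε x hε).symm))
    rw [wi_subst _ _ _ hR, wi_subst _ _ _ hR] at a5
    have hc : R * R⁻¹ = 1 := mul_inv_cancel₀ hR.ne'
    linear_combination R * a5 - ((∫ v, H (x + v / R) * fejK v) - α * ∫ v, stepf (x + v / R) * fejK v) * hc
  simp_rw [h1]
  have h2 : Tendsto (fun x => R * (wiE Φ R 0 x).re) atTop (𝓝 0) := by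
    have := wi_RL Φ R hR
    have := ((Complex.continuous_re.tendsto _).comp this).const_mul R
    simpa [wiE, Function.comp_def] using this
  have h3 : Tendsto (fun x => ∫ v, stepf (x + v / R) * fejK v) atTop (𝓝 (∫ v, fejK v)) := by
    apply tendsto_integral_filter_of_dominated_convergence fejK
    · exact Eventually.of_forall fun x => ((stepf_meas.comp (by fun_prop)).mul fejK_cont.measurable).aestronglyMeasurable
    · refine Eventually.of_forall fun x => ae_of_all _ fun v => ?_
      have := stepf_nonneg (x + v / R)
      have := stepf_le (x + v / R)
      have := fejK_nonneg v
      rw [Real.norm_of_nonneg (by positivity)]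
      nlinarith
    · exact fejK_integrable
    · refine ae_of_all _ fun v => ?_
      refine tendsto_const_nhds.congr' ?_
      filter_upwards [eventually_gt_atTop (-(v / R))] with x hx
      rw [stepf_pos _ (by linarith), one_mul]
  simpa using (h3.const_mul α).add h2

open MeasureTheory Filter Topology Set

lemma fejK_window : Tendsto (fun n : ℕ => ∫ v in (-(n:ℝ))..n, fejK v) atTop (𝓝 (∫ v, fejK v)) :=
  intervalIntegral_tendsto_integral fejK_integrable
    (tendsto_neg_atTop_atBot.comp tendsto_natCast_atTop_atTop) tendsto_natCast_atTop_atTop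

theorem wi_abstract (η α : ℝ) (hη : 0 ≤ η) (hα : 0 ≤ α) (H : ℝ → ℝ) (hH0 : ∀ u, 0 ≤ H u)
    (hneg : ∀ u ≤ 0, H u = 0) (hm : Measurable H)
    (hmono : ∀ u v, u ≤ v → H u ≤ Real.exp (η * (v - u)) * H v)
    (Φ : ℂ → ℂ) (hΦ : ContinuousOn Φ {z | 0 ≤ z.re})
    (hIntg : ∀ ε : ℝ, 0 < ε → Integrable (fun u => H u * Real.exp (-ε * u)))
    (hL : ∀ z : ℂ, 0 < z.re → ∫ u : ℝ, (H u : ℂ) * Complex.exp (-z * u) = α / z + Φ z) :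
    Tendsto H atTop (𝓝 α) := by
  obtain ⟨M, hM⟩ := wi_bounded η α hη hα H hH0 hneg hmono Φ hΦ hIntg hL
  have hJ := wi_J η α hη hα H hH0 hneg hm hmono Φ hΦ hIntg hL
  set κ := ∫ v, fejK v with hκ
  have hκ0 : 0 < κ := fejK_integral_pos
  set k : ℕ → ℝ := fun n => ∫ v in (-(n:ℝ))..n, fejK v with hk
  have hkl : Tendsto k atTop (𝓝 κ) := fejK_window
  have hinv : Tendsto (fun n : ℕ => (n:ℝ)⁻¹) atTop (𝓝 0) := tendsto_inv_atTop_nhds_zero_nat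
  have hexp : ∀ c : ℝ, Tendsto (fun n : ℕ => Real.exp (c * (n:ℝ)⁻¹)) atTop (𝓝 1) := by
    intro c
    have := (Real.continuous_exp.tendsto _).comp (hinv.const_mul c)
    simpa [Function.comp_def] using this
  have hkpos : ∀ n : ℕ, 0 < n → 0 < k n := by
    intro n hn
    have hn' : (0:ℝ) < n := by exact_mod_cast hn
    apply intervalIntegral.integral_pos (by linarith) fejK_cont.continuousOn (fun v _ => fejK_nonneg v)
    exact ⟨0, by simp, fejK_zero⟩
  have hHi : ∀ R x : ℝ, Integrable (fun v => H (x + v / R) * fejK v) := by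
    intro R x
    refine (fejK_integrable.const_mul M).mono' ((hm.comp (by fun_prop)).mul fejK_cont.measurable).aestronglyMeasurable
      (ae_of_all _ fun v => ?_)
    have h1 := hH0 (x + v / R)
    have h2 := fejK_nonneg v
    have h3 := hM (x + v / R)
    rw [Real.norm_of_nonneg (by positivity)]
    gcongr
  -- comparison on the window
  have hwin : ∀ n : ℕ, 0 < n → ∀ x v : ℝ, -(n:ℝ) ≤ v → v ≤ n →
      Real.exp (-(2 * η) * (n:ℝ)⁻¹) * H (x - (n:ℝ)⁻¹) ≤ H (x + v / (n:ℝ)^2) ∧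
      H (x + v / (n:ℝ)^2) ≤ Real.exp ((2 * η) * (n:ℝ)⁻¹) * H (x + (n:ℝ)⁻¹) := by
    intro n hn x v hv1 hv2
    have hn' : (0:ℝ) < n := by exact_mod_cast hn
    have b1 : v / (n:ℝ)^2 ≤ (n:ℝ)⁻¹ := by
      rw [div_le_iff₀ (by positivity)]
      calc v ≤ n := hv2
        _ = (n:ℝ)⁻¹ * n ^ 2 := by field_simp
    have b2 : -(n:ℝ)⁻¹ ≤ v / (n:ℝ)^2 := by
      rw [le_div_iff₀ (by positivity)]
      calc -(n:ℝ)⁻¹ * n ^ 2 = -n := by field_simp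
        _ ≤ v := hv1
    have hi : 0 < (n:ℝ)⁻¹ := by positivity
    constructor
    · have := hmono (x - (n:ℝ)⁻¹) (x + v / (n:ℝ)^2) (by linarith)
      have e : Real.exp (η * (x + v / (n:ℝ)^2 - (x - (n:ℝ)⁻¹))) ≤ Real.exp ((2 * η) * (n:ℝ)⁻¹) := by
        apply Real.exp_le_exp.mpr; nlinarith
      calc _ ≤ Real.exp (-(2 * η) * (n:ℝ)⁻¹) * (Real.exp ((2 * η) * (n:ℝ)⁻¹) * H (x + v / (n:ℝ)^2)) := by
            gcongr
            exact this.trans (mul_le_mul_of_nonneg_right e (hH0 _))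
        _ = _ := by rw [← mul_assoc, ← Real.exp_add]; simp
    · have := hmono (x + v / (n:ℝ)^2) (x + (n:ℝ)⁻¹) (by linarith)
      refine this.trans (mul_le_mul_of_nonneg_right ?_ (hH0 _))
      apply Real.exp_le_exp.mpr; nlinarith
  have hup : ∀ n : ℕ, 0 < n → ∀ᶠ x in atTop, H x ≤ Real.exp ((2 * η) * (n:ℝ)⁻¹) * (α * κ + (n:ℝ)⁻¹) / k n := by
    intro n hn
    have hn' : (0:ℝ) < n := by exact_mod_cast hn
    have h1 := (hJ ((n:ℝ)^2) (by positivity)).eventually_le_const (show α * κ < α * κ + (n:ℝ)⁻¹ by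
      have : 0 < (n:ℝ)⁻¹ := by positivity
      linarith)
    have h2 := (tendsto_atTop_add_const_right atTop ((n:ℝ)⁻¹) tendsto_id).eventually h1
    filter_upwards [h2] with x hx
    simp only [id] at hx
    have h3 : Real.exp (-(2 * η) * (n:ℝ)⁻¹) * H x * k n ≤ ∫ v, H (x + (n:ℝ)⁻¹ + v / (n:ℝ)^2) * fejK v := by
      calc _ = ∫ v in Ioc (-(n:ℝ)) n, Real.exp (-(2 * η) * (n:ℝ)⁻¹) * H x * fejK v := by
            rw [← intervalIntegral.integral_of_le (by linarith), intervalIntegral.integral_const_mul]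
        _ ≤ ∫ v in Ioc (-(n:ℝ)) n, H (x + (n:ℝ)⁻¹ + v / (n:ℝ)^2) * fejK v := by
            apply setIntegral_mono_on (fejK_integrable.const_mul _).integrableOn (hHi _ _).integrableOn measurableSet_Ioc
            intro v hv
            apply mul_le_mul_of_nonneg_right _ (fejK_nonneg v)
            have := (hwin n hn (x + (n:ℝ)⁻¹) v hv.1.le hv.2).1
            simpa using this
        _ ≤ _ := setIntegral_le_integral (hHi _ _) (ae_of_all _ fun v => mul_nonneg (hH0 _) (fejK_nonneg v))
    rw [le_div_iff₀ (hkpos n hn)]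
    calc H x * k n = Real.exp ((2 * η) * (n:ℝ)⁻¹) * (Real.exp (-(2 * η) * (n:ℝ)⁻¹) * H x * k n) := by
          rw [← mul_assoc, ← mul_assoc, ← Real.exp_add]; simp
      _ ≤ _ := by gcongr; exact h3.trans hx
  have hlo : ∀ n : ℕ, 0 < n → ∀ᶠ x in atTop,
      Real.exp (-(2 * η) * (n:ℝ)⁻¹) * (α * κ - (n:ℝ)⁻¹ - M * (κ - k n)) / k n ≤ H x := by
    intro n hn
    have hn' : (0:ℝ) < n := by exact_mod_cast hn
    have h1 := (hJ ((n:ℝ)^2) (by positivity)).eventually_const_le (show α * κ - (n:ℝ)⁻¹ < α * κ by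
      have : 0 < (n:ℝ)⁻¹ := by positivity
      linarith)
    have h2 := (tendsto_atTop_add_const_right atTop (-(n:ℝ)⁻¹) tendsto_id).eventually h1
    filter_upwards [h2] with x hx
    simp only [id] at hx
    have h3 : ∫ v, H (x + -(n:ℝ)⁻¹ + v / (n:ℝ)^2) * fejK v ≤
        Real.exp ((2 * η) * (n:ℝ)⁻¹) * H x * k n + M * (κ - k n) := by
      rw [← integral_add_compl (measurableSet_Ioc (a := -(n:ℝ)) (b := n)) (hHi _ _)]
      have hkk : k n = ∫ v in Ioc (-(n:ℝ)) n, fejK v := intervalIntegral.integral_of_le (by linarith)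
      have e1 : κ - k n = ∫ v in (Ioc (-(n:ℝ)) n)ᶜ, fejK v := by
        rw [hkk, hκ, ← integral_add_compl (measurableSet_Ioc (a := -(n:ℝ)) (b := n)) fejK_integrable]; ring
      apply add_le_add
      · rw [hkk, ← integral_const_mul]
        apply setIntegral_mono_on (hHi _ _).integrableOn (fejK_integrable.const_mul _).integrableOn measurableSet_Ioc
        intro v hv
        apply mul_le_mul_of_nonneg_right _ (fejK_nonneg v)
        have := (hwin n hn (x + -(n:ℝ)⁻¹) v hv.1.le hv.2).2
        simpa using this
      · rw [e1, ← integral_const_mul]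
        apply setIntegral_mono_on (hHi _ _).integrableOn (fejK_integrable.const_mul _).integrableOn measurableSet_Ioc.compl
        intro v hv
        exact mul_le_mul_of_nonneg_right (hM _) (fejK_nonneg v)
    rw [div_le_iff₀ (hkpos n hn)]
    calc _ ≤ Real.exp (-(2 * η) * (n:ℝ)⁻¹) * (Real.exp ((2 * η) * (n:ℝ)⁻¹) * H x * k n) := by
          gcongr; linarith
      _ = _ := by
          rw [← mul_assoc, ← mul_assoc, ← Real.exp_add]; simp
  have hupl : Tendsto (fun n : ℕ => Real.exp ((2 * η) * (n:ℝ)⁻¹) * (α * κ + (n:ℝ)⁻¹) / k n) atTop (𝓝 α) := by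
    have := ((hexp (2 * η)).mul (hinv.const_add (α * κ))).div hkl hκ0.ne'
    simpa [hκ0.ne', Pi.div_def] using this
  have hlol : Tendsto (fun n : ℕ => Real.exp (-(2 * η) * (n:ℝ)⁻¹) * (α * κ - (n:ℝ)⁻¹ - M * (κ - k n)) / k n) atTop (𝓝 α) := by
    have := ((hexp (-(2 * η))).mul ((hinv.const_sub (α * κ)).sub ((hkl.const_sub κ).const_mul M))).div hkl hκ0.ne'
    simpa [hκ0.ne', Pi.div_def] using this
  rw [tendsto_order]
  constructor
  · intro a ha
    obtain ⟨n, hn1, hn2⟩ := ((hlol.eventually_const_lt ha).and (eventually_gt_atTop 0)).exists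
    filter_upwards [hlo n hn2] with x hx using hn1.trans_le hx
  · intro a ha
    obtain ⟨n, hn1, hn2⟩ := ((hupl.eventually_lt_const ha).and (eventually_gt_atTop 0)).exists
    filter_upwards [hup n hn2] with x hx using hx.trans_lt hn1

open MeasureTheory Filter Topology Set

section dirichlet
variable {ι : Type*}

/-- Counting function of a weighted family of lengths. -/
noncomputable def cntA (c lam : ι → ℝ) (T : ℝ) : ℝ :=
  ∑' p, (if lam p ≤ T then c p else 0)

lemma cntA_summable (c lam : ι → ℝ) (hc : ∀ p, 0 ≤ c p) (σ : ℝ) (hσ : 0 ≤ σ)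
    (hs : Summable fun p => c p * Real.exp (-σ * lam p)) (T : ℝ) :
    Summable fun p => (if lam p ≤ T then c p else 0) := by
  refine Summable.of_nonneg_of_le (fun p => ?_) (fun p => ?_) (hs.mul_left (Real.exp (σ * T)))
  · split_ifs
    · exact hc p
    · exact le_rfl
  · split_ifs with h
    · have : 1 ≤ Real.exp (σ * T) * Real.exp (-σ * lam p) := by
        rw [← Real.exp_add, Real.one_le_exp_iff]; nlinarith
      nlinarith [hc p]
    · have := hc p; positivity

lemma cntA_nonneg (c lam : ι → ℝ) (hc : ∀ p, 0 ≤ c p) (T : ℝ) : 0 ≤ cntA c lam T :=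
  tsum_nonneg fun p => by split_ifs; exacts [hc p, le_rfl]

lemma cntA_mono (c lam : ι → ℝ) (hc : ∀ p, 0 ≤ c p)
    (hs : ∀ T, Summable fun p => (if lam p ≤ T then c p else 0)) : Monotone (cntA c lam) := by
  intro a b hab
  refine (hs a).tsum_le_tsum (fun p => ?_) (hs b)
  have := hc p
  split_ifs <;> first | linarith | skip

lemma wi_laplace [Countable ι] (c lam : ι → ℝ) (hc : ∀ p, 0 ≤ c p) (s : ℂ) (hs0 : 0 < s.re)
    (hs : Summable fun p => c p * Real.exp (-s.re * lam p)) :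
    ∫ u : ℝ, (cntA c lam u : ℂ) * Complex.exp (-s * u) = (∑' p, (c p : ℂ) * Complex.exp (-s * lam p)) / s := by
  have hsne : s ≠ 0 := by rintro rfl; simp at hs0
  set F : ι → ℝ → ℂ := fun p => (Ici (lam p)).indicator (fun u : ℝ => (c p : ℂ) * Complex.exp (-s * u)) with hF
  have hFi : ∀ p, Integrable (F p) := by
    intro p
    rw [hF, integrable_indicator_iff measurableSet_Ici, integrableOn_Ici_iff_integrableOn_Ioi]
    exact (integrableOn_exp_mul_complex_Ioi (by simpa using hs0) _).const_mul _
  have hFint : ∀ p, ∫ u, F p u = (c p : ℂ) * Complex.exp (-s * lam p) / s := by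
    intro p
    rw [hF, integral_indicator measurableSet_Ici, integral_Ici_eq_integral_Ioi, integral_const_mul,
      integral_exp_mul_complex_Ioi (by simpa using hs0)]
    rw [neg_div_neg_eq]; ring
  have hFn : ∀ p, ∫ u, ‖F p u‖ = c p * Real.exp (-s.re * lam p) / s.re := by
    intro p
    have : ∀ u, ‖F p u‖ = (Ici (lam p)).indicator (fun u : ℝ => c p * Real.exp (-s.re * u)) u := by
      intro u
      rw [hF]
      simp only [norm_indicator_eq_indicator_norm]
      congr 1; ext v
      rw [norm_mul, Complex.norm_real, Real.norm_of_nonneg (hc p), Complex.norm_exp]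
      simp
    simp_rw [this]
    rw [integral_indicator measurableSet_Ici, integral_Ici_eq_integral_Ioi, integral_const_mul,
      integral_exp_mul_Ioi (by linarith)]
    rw [neg_div_neg_eq]; ring
  have hsum := hasSum_integral_of_summable_integral_norm hFi (by
    simp_rw [hFn]; exact hs.div_const _)
  have e : ∀ u, ∑' p, F p u = (cntA c lam u : ℂ) * Complex.exp (-s * u) := by
    intro u
    unfold cntA
    rw [Complex.ofReal_tsum, ← tsum_mul_right]
    congr 1; ext p
    simp only [hF, indicator, mem_Ici]
    split_ifs <;> simp
  simp_rw [e, hFint] at hsum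
  rw [← hsum.tsum_eq, tsum_div_const]

theorem wi_dirichlet [Countable ι] (c lam : ι → ℝ) (hc : ∀ p, 0 ≤ c p) (l₀ : ℝ) (hl₀ : 0 < l₀)
    (hlam : ∀ p, l₀ ≤ lam p) (η : ℝ) (hη : 0 < η)
    (hs : ∀ σ, η < σ → Summable fun p => c p * Real.exp (-σ * lam p))
    (Φ : ℂ → ℂ) (hΦ : ContinuousOn Φ {s | η ≤ s.re})
    (hD : ∀ s : ℂ, η < s.re → ∑' p, (c p : ℂ) * Complex.exp (-s * lam p) = 1 / (s - η) + Φ s) :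
    Tendsto (fun T => Real.exp (-η * T) * cntA c lam T) atTop (𝓝 (1 / η)) := by
  have hsT := cntA_summable c lam hc (2 * η) (by linarith) (hs _ (by linarith))
  have hmono := cntA_mono c lam hc hsT
  have hnn := cntA_nonneg c lam hc
  have hneg : ∀ u ≤ 0, cntA c lam u = 0 := by
    intro u hu
    unfold cntA
    have : ∀ p, ¬ lam p ≤ u := fun p => by have := hlam p; linarith
    simp [this]
  have hlap : ∀ z : ℂ, 0 < z.re → ∫ u : ℝ, ((Real.exp (-η * u) * cntA c lam u : ℝ) : ℂ) * Complex.exp (-z * u)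
      = (∑' p, (c p : ℂ) * Complex.exp (-(η + z) * lam p)) / (η + z) := by
    intro z hz
    rw [← wi_laplace c lam hc (η + z) (by simp; linarith) (by
      simpa using hs (η + z.re) (by linarith))]
    congr 1; ext u
    rw [show -(η + z) * u = -η * u + -z * u by ring, Complex.exp_add]
    push_cast; ring
  refine wi_abstract η (1 / η) hη.le (by positivity) _ (fun u => mul_nonneg (Real.exp_pos _).le (hnn u))
    (fun u hu => by rw [hneg u hu, mul_zero]) ((by fun_prop : Measurable fun u : ℝ => Real.exp (-η * u)).mul hmono.measurable)
    ?_ (fun z => (Φ (η + z) - 1 / η) / (η + z)) ?_ ?_ ?_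
  · intro u v huv
    rw [← mul_assoc, ← Real.exp_add, show η * (v - u) + -η * v = -η * u by ring]
    exact mul_le_mul_of_nonneg_left (hmono huv) (Real.exp_pos _).le
  · refine ContinuousOn.div ((hΦ.comp (by fun_prop) ?_).sub continuousOn_const) (by fun_prop) ?_
    · intro z hz
      simp only [mem_setOf_eq] at hz ⊢
      simpa using hz
    · intro z hz h
      have := congrArg Complex.re h
      simp only [mem_setOf_eq] at hz
      simp at this
      linarith
  · intro ε hε
    by_cases hall : ∀ p, c p = 0
    · have : ∀ u, cntA c lam u = 0 := fun u => by simp [cntA, hall]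
      simp [this]
    · push Not at hall
      obtain ⟨q, hq⟩ := hall
      have h1 := hlap ε (by simpa using hε)
      have h2 : (∑' p, (c p : ℂ) * Complex.exp (-(η + (ε:ℂ)) * lam p)) / (η + (ε:ℂ)) ≠ 0 := by
        apply div_ne_zero
        · have : ∀ p, (c p : ℂ) * Complex.exp (-(η + (ε:ℂ)) * lam p) = ((c p * Real.exp (-(η + ε) * lam p) : ℝ) : ℂ) := by
            intro p; push_cast; rfl
          simp_rw [this]
          rw [← Complex.ofReal_tsum, Complex.ofReal_ne_zero]
          refine ((hs (η + ε) (by linarith)).tsum_pos (fun p => ?_) q ?_).ne'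
          · have := hc p; positivity
          · have := lt_of_le_of_ne (hc q) hq.symm; positivity
        · rw [← Complex.ofReal_add, Complex.ofReal_ne_zero]; linarith
      rw [← h1] at h2
      have h3 := (not_imp_comm.1 integral_undef h2).re
      refine h3.congr (ae_of_all _ fun u => ?_)
      have : ((Real.exp (-η * u) * cntA c lam u : ℝ) : ℂ) * Complex.exp (-(ε:ℂ) * u)
        = ((Real.exp (-η * u) * cntA c lam u * Real.exp (-ε * u) : ℝ) : ℂ) := by push_cast; rfl
      simp only [this]
      exact Complex.ofReal_re _
  · intro z hz
    rw [hlap z hz, hD (η + z) (by simpa using hz)]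
    have hz0 : z ≠ 0 := by rintro rfl; simp at hz
    have hη0 : (η : ℂ) ≠ 0 := by exact_mod_cast hη.ne'
    have hez : (η : ℂ) + z ≠ 0 := by
      intro h
      have := congrArg Complex.re h
      simp at this
      linarith
    push_cast
    rw [add_sub_cancel_left]
    field_simp
    ring
end dirichlet

open MeasureTheory Filter Topology Set
section orbit
variable {L : Type*}

noncomputable def orbC (l w : L → ℝ) (p : L × ℕ) : ℝ := l p.1 * w p.1 ^ (p.2 + 1)
noncomputable def orbLam (l : L → ℝ) (p : L × ℕ) : ℝ := ((p.2 : ℝ) + 1) * l p.1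

lemma orb_summable (l w : L → ℝ) (l₀ : ℝ) (hl₀ : 0 < l₀)
    (hl : ∀ γ, l₀ ≤ l γ) (hw : ∀ γ, 0 ≤ w γ) (η : ℝ)
    (hconv : ∀ σ : ℝ, η < σ →
      Summable (fun p : L × ℕ =>
        w p.1 ^ (p.2 + 1) * Real.exp (-((p.2 : ℝ) + 1) * σ * l p.1) / ((p.2 : ℝ) + 1)))
    (σ : ℝ) (hσ : η < σ) : Summable fun p => orbC l w p * Real.exp (-σ * orbLam l p) := by
  set d := (σ - η) / 2 with hd
  have hd0 : 0 < d := by rw [hd]; linarith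
  refine Summable.of_nonneg_of_le (fun p => ?_) (fun p => ?_) ((hconv (σ - d) (by linarith)).mul_right (1 / d))
  · have := hw p.1; have := hl p.1
    have : 0 ≤ l p.1 := by linarith
    unfold orbC; positivity
  · have h1 := hw p.1
    have h2 : 0 < l p.1 := hl₀.trans_le (hl p.1)
    have hk : (0:ℝ) < (p.2:ℝ) + 1 := by positivity
    unfold orbC orbLam
    have e : Real.exp (-σ * (((p.2:ℝ) + 1) * l p.1)) =
      Real.exp (-((p.2 : ℝ) + 1) * (σ - d) * l p.1) * Real.exp (-(d * (((p.2:ℝ) + 1) * l p.1))) := by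
      rw [← Real.exp_add]; congr 1; ring
    have h3 : d * (((p.2:ℝ) + 1) * l p.1) * Real.exp (-(d * (((p.2:ℝ) + 1) * l p.1))) ≤ 1 := by
      rw [Real.exp_neg, ← div_eq_mul_inv, div_le_one (Real.exp_pos _)]
      have := Real.add_one_le_exp (d * (((p.2:ℝ) + 1) * l p.1))
      linarith
    rw [e]
    calc _ = (w p.1 ^ (p.2 + 1) * Real.exp (-((p.2 : ℝ) + 1) * (σ - d) * l p.1) / ((p.2 : ℝ) + 1)) * (1 / d)
          * (d * (((p.2:ℝ) + 1) * l p.1) * Real.exp (-(d * (((p.2:ℝ) + 1) * l p.1)))) := by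
          field_simp
      _ ≤ _ := mul_le_of_le_one_right (by positivity) h3

lemma orb_zeta_deriv (l w : L → ℝ) (l₀ : ℝ) (hl₀ : 0 < l₀)
    (hl : ∀ γ, l₀ ≤ l γ) (hw : ∀ γ, 0 ≤ w γ) (η : ℝ)
    (hconv : ∀ σ : ℝ, η < σ →
      Summable (fun p : L × ℕ =>
        w p.1 ^ (p.2 + 1) * Real.exp (-((p.2 : ℝ) + 1) * σ * l p.1) / ((p.2 : ℝ) + 1)))
    (s : ℂ) (hs : η < s.re) :
    HasDerivAt (zetaLog l w) (-∑' p, (orbC l w p : ℂ) * Complex.exp (-s * orbLam l p)) s := by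
  set σ := (η + s.re) / 2 with hσ
  set V : Set ℂ := {z | σ < z.re} with hV
  have hVo : IsOpen V := isOpen_lt continuous_const Complex.continuous_re
  have hsV : s ∈ V := by change σ < s.re; rw [hσ]; linarith
  set F : L × ℕ → ℂ → ℂ := fun p s => (w p.1 : ℂ) ^ (p.2 + 1) *
    Complex.exp (-((p.2 : ℂ) + 1) * s * (l p.1 : ℂ)) / ((p.2 : ℂ) + 1) with hF
  have hd : ∀ p z, HasDerivAt (F p) (-((orbC l w p : ℂ) * Complex.exp (-z * orbLam l p))) z := by
    intro p z
    have hk : ((p.2 : ℂ) + 1) ≠ 0 := by exact_mod_cast Nat.succ_ne_zero p.2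
    have h1 : HasDerivAt (fun z : ℂ => -((p.2 : ℂ) + 1) * z * (l p.1 : ℂ)) (-((p.2 : ℂ) + 1) * (l p.1 : ℂ)) z := by
      simpa using ((hasDerivAt_id z).const_mul (-((p.2 : ℂ) + 1))).mul_const (l p.1 : ℂ)
    refine ((h1.cexp.const_mul ((w p.1 : ℂ) ^ (p.2 + 1))).div_const ((p.2 : ℂ) + 1)).congr_deriv ?_
    unfold orbC orbLam
    push_cast
    rw [show -z * (((p.2:ℂ) + 1) * (l p.1 : ℂ)) = -((p.2 : ℂ) + 1) * z * (l p.1 : ℂ) by ring]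
    field_simp
  have hle : ∀ p z, z ∈ V → ‖F p z‖ ≤ w p.1 ^ (p.2 + 1) * Real.exp (-((p.2 : ℝ) + 1) * σ * l p.1) / ((p.2 : ℝ) + 1) := by
    intro p z hz
    have h1 := hw p.1
    have h2 : 0 < l p.1 := hl₀.trans_le (hl p.1)
    have hk : (0:ℝ) < (p.2:ℝ) + 1 := by positivity
    have e1 : ‖((p.2 : ℂ) + 1)‖ = (p.2:ℝ) + 1 := by
      rw [show ((p.2 : ℂ) + 1) = (((p.2:ℝ) + 1 : ℝ) : ℂ) by push_cast; rfl, Complex.norm_real, Real.norm_of_nonneg hk.le]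
    have e2 : (-((p.2 : ℂ) + 1) * z * (l p.1 : ℂ)).re = -((p.2 : ℝ) + 1) * z.re * l p.1 := by
      rw [show (-((p.2 : ℂ) + 1) * z * (l p.1 : ℂ)) = ((-((p.2:ℝ) + 1) * l p.1 : ℝ) : ℂ) * z by push_cast; ring,
        Complex.re_ofReal_mul]; ring
    simp only [hF]
    rw [norm_div, norm_mul, norm_pow, Complex.norm_real, Real.norm_of_nonneg h1, Complex.norm_exp, e1, e2]
    have hz' : σ < z.re := hz
    have : -((p.2 : ℝ) + 1) * z.re * l p.1 ≤ -((p.2 : ℝ) + 1) * σ * l p.1 := by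
      have : 0 < ((p.2 : ℝ) + 1) * l p.1 := by positivity
      nlinarith
    gcongr
  have hu := hconv σ (by rw [hσ]; linarith)
  have hdiff : ∀ p, DifferentiableOn ℂ (F p) V := fun p z _ => (hd p z).differentiableAt.differentiableWithinAt
  have h1 := Complex.hasSum_deriv_of_summable_norm hu hdiff hVo hle hsV
  have h2 := (Complex.differentiableOn_tsum_of_summable_norm hu hdiff hVo hle).differentiableAt (hVo.mem_nhds hsV)
  have h3 := h2.hasDerivAt
  rw [← h1.tsum_eq] at h3
  simp_rw [(hd _ s).deriv] at h3
  rw [tsum_neg] at h3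
  exact h3

lemma orb_wi [Countable L] (l w : L → ℝ) (l₀ : ℝ) (hl₀ : 0 < l₀)
    (hl : ∀ γ, l₀ ≤ l γ) (hw : ∀ γ, 0 ≤ w γ) (η : ℝ) (hη : 0 < η)
    (hconv : ∀ σ : ℝ, η < σ →
      Summable (fun p : L × ℕ =>
        w p.1 ^ (p.2 + 1) * Real.exp (-((p.2 : ℝ) + 1) * σ * l p.1) / ((p.2 : ℝ) + 1)))
    (hext : ∃ U : Set ℂ, IsOpen U ∧ {s : ℂ | η ≤ s.re} ⊆ U ∧
      ∃ g : ℂ → ℂ, AnalyticOnNhd ℂ g U ∧ (∀ s ∈ U, g s ≠ 0) ∧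
        ∀ s ∈ U, η < s.re →
          Complex.exp (zetaLog l w s) = g s / (s - (η : ℂ))) :
    Tendsto (fun T => Real.exp (-η * T) * cntA (orbC l w) (orbLam l) T) atTop (𝓝 (1 / η)) := by
  obtain ⟨U, hU, hsub, g, hg, hg0, hZ⟩ := hext
  have hlpos : ∀ γ, 0 < l γ := fun γ => hl₀.trans_le (hl γ)
  refine wi_dirichlet (orbC l w) (orbLam l) (fun p => ?_) l₀ hl₀ (fun p => ?_) η hη
    (orb_summable l w l₀ hl₀ hl hw η hconv) (fun s => -(deriv g s / g s)) ?_ ?_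
  · have := hw p.1; have := hlpos p.1; unfold orbC; positivity
  · unfold orbLam
    have := hl p.1
    have : (0:ℝ) ≤ p.2 := by positivity
    nlinarith [hlpos p.1]
  · intro s hs
    have hsU := hsub hs
    exact (((hg s hsU).deriv.continuousAt.div (hg s hsU).continuousAt (hg0 s hsU)).neg).continuousWithinAt
  · intro s hs
    have hsU : s ∈ U := hsub (show η ≤ s.re from hs.le)
    have hne : s - (η:ℂ) ≠ 0 := by
      intro h
      have := congrArg Complex.re h
      simp at this
      linarith
    have h1 := (orb_zeta_deriv l w l₀ hl₀ hl hw η hconv s hs).cexp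
    have h2 : HasDerivAt (fun z => g z / (z - (η:ℂ))) _ s :=
      (hg s hsU).differentiableAt.hasDerivAt.div ((hasDerivAt_id s).sub_const (η:ℂ)) hne
    have h3 : (fun z => Complex.exp (zetaLog l w z)) =ᶠ[𝓝 s] (fun z => g z / (z - (η:ℂ))) := by
      filter_upwards [hU.mem_nhds hsU, (isOpen_lt continuous_const Complex.continuous_re).mem_nhds (show s ∈ {z : ℂ | η < z.re} from hs)] with z h1 h2
      exact hZ z h1 h2
    have h4 := (h1.congr_of_eventuallyEq h3.symm).unique h2
    rw [hZ s hsU hs] at h4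
    have hgs := hg0 s hsU
    field_simp at h4 ⊢
    linear_combination -h4
end orbit

open MeasureTheory Filter Topology Set

open Classical in
lemma cntA_jump {ι : Type*} (c lam : ι → ℝ) (hc : ∀ p, 0 ≤ c p) (η : ℝ) (hη : 0 < η)
    (hs : ∀ T, Summable fun p => (if lam p ≤ T then c p else 0))
    (hH : Tendsto (fun T => Real.exp (-η * T) * cntA c lam T) atTop (𝓝 (1 / η)))
    (ε : ℝ) (hε : 0 < ε) : ∃ R, ∀ p, R ≤ lam p → c p * Real.exp (-η * lam p) ≤ ε := by
  have h1 : Tendsto (fun T => Real.exp (-η * T) * cntA c lam T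
      - Real.exp (-η * (ε / 2)) * (Real.exp (-η * (T + -(ε / 2))) * cntA c lam (T + -(ε / 2)))) atTop
      (𝓝 (1 / η - Real.exp (-η * (ε / 2)) * (1 / η))) :=
    hH.sub ((hH.comp (tendsto_atTop_add_const_right atTop (-(ε / 2)) tendsto_id)).const_mul _)
  have h2 : 1 / η - Real.exp (-η * (ε / 2)) * (1 / η) < ε := by
    have := Real.add_one_le_exp (-η * (ε / 2))
    have h3 : 1 / η - Real.exp (-η * (ε / 2)) * (1 / η) = (1 - Real.exp (-η * (ε / 2))) / η := by ring
    rw [h3, div_lt_iff₀ hη]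
    nlinarith
  obtain ⟨R, hR⟩ := eventually_atTop.mp (h1.eventually_lt_const h2)
  refine ⟨R, fun p hp => ?_⟩
  have h3 := hR _ hp
  have h4 : cntA c lam (lam p + -(ε / 2)) + c p ≤ cntA c lam (lam p) := by
    unfold cntA
    have hsing := hasSum_ite_eq p (c p)
    rw [← hsing.tsum_eq, ← (hs _).tsum_add hsing.summable]
    refine ((hs _).add hsing.summable).tsum_le_tsum (fun q => ?_) (hs _)
    have := hc q
    by_cases hq : q = p
    · subst hq
      rw [if_neg (by linarith), if_pos rfl, if_pos le_rfl]; simp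
    · rw [if_neg hq]
      split_ifs <;> linarith
  have e : Real.exp (-η * (ε / 2)) * (Real.exp (-η * (lam p + -(ε / 2))) * cntA c lam (lam p + -(ε / 2)))
      = Real.exp (-η * lam p) * cntA c lam (lam p + -(ε / 2)) := by
    rw [← mul_assoc, ← Real.exp_add]; congr 2; ring
  rw [e] at h3
  nlinarith [Real.exp_pos (-η * lam p)]

lemma cntA_bdd {ι : Type*} (c lam : ι → ℝ) (hc : ∀ p, 0 ≤ c p) (η : ℝ) (hη : 0 < η)
    (hlam : ∀ p, 0 < lam p)
    (hs : ∀ T, Summable fun p => (if lam p ≤ T then c p else 0))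
    (hH : Tendsto (fun T => Real.exp (-η * T) * cntA c lam T) atTop (𝓝 (1 / η))) :
    ∃ C, 0 ≤ C ∧ ∀ T, cntA c lam T ≤ C * Real.exp (η * T) := by
  obtain ⟨X, hX⟩ := eventually_atTop.mp (hH.eventually_lt_const (show 1 / η < 1 / η + 1 by linarith))
  have hm := cntA_mono c lam hc hs
  have hη' : 0 < 1 / η := by positivity
  have hnn := cntA_nonneg c lam hc X
  refine ⟨1 / η + 1 + cntA c lam X, by linarith, fun T => ?_⟩
  rcases le_or_gt T 0 with hT | hT
  · have : cntA c lam T = 0 := by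
      unfold cntA
      have : ∀ p, ¬ lam p ≤ T := fun p => by have := hlam p; linarith
      simp [this]
    rw [this]; positivity
  · rcases le_total X T with h | h
    · have h1 := hX T h
      calc cntA c lam T = (Real.exp (-η * T) * cntA c lam T) * Real.exp (η * T) := by
            rw [mul_comm (Real.exp (-η * T)), mul_assoc, ← Real.exp_add]; simp
        _ ≤ _ := by gcongr; linarith
    · have h1 : 1 ≤ Real.exp (η * T) := Real.one_le_exp (by positivity)
      have := hm h
      nlinarith

section fin
variable {L : Type*}

lemma orb_block (l w : L → ℝ) (hl : ∀ γ, 0 < l γ) (hw : ∀ γ, 0 ≤ w γ) (η : ℝ) (hη : 0 < η)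
    (hs : ∀ T, Summable fun p => (if orbLam l p ≤ T then orbC l w p else 0))
    (ha1 : ∀ γ, w γ * Real.exp (-η * l γ) ≤ 1) (C : ℝ)
    (hC : ∀ T, cntA (orbC l w) (orbLam l) T ≤ C * Real.exp (η * T))
    (k : ℕ) (R ρ T : ℝ) (hρ0 : 0 ≤ ρ) (hρ : ∀ γ, R < l γ → (w γ * Real.exp (-η * l γ)) ^ k ≤ ρ) :
    ∑' γ, (if ((k:ℝ) + 1) * l γ ≤ T then l γ * w γ ^ (k + 1) else 0) ≤
      Real.exp (η * k * R) * cntA (fun γ => l γ * w γ) l R + ρ * C * Real.exp (η * T) := by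
  have hinj : Function.Injective (fun γ : L => ((γ, 0) : L × ℕ)) := fun a b h => congrArg Prod.fst h
  have hs1 : ∀ T, Summable fun γ => (if l γ ≤ T then l γ * w γ else 0) := by
    intro T
    have := (hs T).comp_injective hinj
    simpa [Function.comp_def, orbLam, orbC] using this
  have hA : ∀ T, cntA (fun γ => l γ * w γ) l T ≤ C * Real.exp (η * T) := by
    intro T
    refine le_trans ?_ (hC T)
    unfold cntA
    have h1 := tsum_comp_le_tsum_of_inj (hs T) (fun p => ?_) hinj
    · simpa [Function.comp_def, orbLam, orbC] using h1
    · have := hw p.1; have := hl p.1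
      split_ifs
      · unfold orbC; positivity
      · simp
  have hk : (0:ℝ) < (k:ℝ) + 1 := by positivity
  have hw_eq : ∀ γ, w γ ^ k = (w γ * Real.exp (-η * l γ)) ^ k * Real.exp (η * k * l γ) := by
    intro γ
    rw [mul_pow, mul_assoc, ← Real.exp_nat_mul, ← Real.exp_add]
    rw [show (k:ℝ) * (-η * l γ) + η * k * l γ = 0 by ring]; simp
  have hkey : ∀ γ, (if ((k:ℝ) + 1) * l γ ≤ T then l γ * w γ ^ (k + 1) else 0) ≤
      Real.exp (η * k * R) * (if l γ ≤ R then l γ * w γ else 0) +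
      ρ * Real.exp (η * k * (T / (k + 1))) * (if l γ ≤ T / (k + 1) then l γ * w γ else 0) := by
    intro γ
    have h1 := hl γ
    have h2 := hw γ
    have hlw : 0 ≤ l γ * w γ := by positivity
    by_cases hT : ((k:ℝ) + 1) * l γ ≤ T
    · have hT' : l γ ≤ T / (k + 1) := by rw [le_div_iff₀ hk]; linarith
      rw [if_pos hT, if_pos hT', pow_succ, hw_eq γ]
      have ha0 : 0 ≤ w γ * Real.exp (-η * l γ) := by positivity
      by_cases hR : l γ ≤ R
      · rw [if_pos hR]
        have b1 : (w γ * Real.exp (-η * l γ)) ^ k * Real.exp (η * k * l γ) ≤ 1 * Real.exp (η * k * R) := by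
          gcongr
          exact pow_le_one₀ ha0 (ha1 γ)
        have b2 : 0 ≤ ρ * Real.exp (η * k * (T / (k + 1))) * (l γ * w γ) := by positivity
        nlinarith
      · rw [if_neg hR]
        have b1 : (w γ * Real.exp (-η * l γ)) ^ k * Real.exp (η * k * l γ) ≤ ρ * Real.exp (η * k * (T / (k + 1))) := by
          gcongr
          exact hρ γ (not_le.mp hR)
        nlinarith
    · rw [if_neg hT]
      have : 0 ≤ (if l γ ≤ R then l γ * w γ else 0) := by split_ifs <;> simp [hlw]
      have : 0 ≤ (if l γ ≤ T / (k + 1) then l γ * w γ else 0) := by split_ifs <;> simp [hlw]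
      positivity
  have hsr := ((hs1 R).mul_left (Real.exp (η * k * R))).add
    ((hs1 (T / (k + 1))).mul_left (ρ * Real.exp (η * k * (T / (k + 1)))))
  have hsl : Summable fun γ => (if ((k:ℝ) + 1) * l γ ≤ T then l γ * w γ ^ (k + 1) else 0) := by
    refine Summable.of_nonneg_of_le (fun γ => ?_) hkey hsr
    have := hl γ; have := hw γ
    split_ifs
    · positivity
    · simp
  calc _ ≤ _ := hsl.tsum_le_tsum hkey hsr
    _ = Real.exp (η * k * R) * cntA (fun γ => l γ * w γ) l R +
        ρ * Real.exp (η * k * (T / (k + 1))) * cntA (fun γ => l γ * w γ) l (T / (k + 1)) := by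
      rw [((hs1 R).mul_left _).tsum_add ((hs1 (T / (k + 1))).mul_left _), tsum_mul_left, tsum_mul_left]; rfl
    _ ≤ Real.exp (η * k * R) * cntA (fun γ => l γ * w γ) l R +
        ρ * Real.exp (η * k * (T / (k + 1))) * (C * Real.exp (η * (T / (k + 1)))) := by
      gcongr; exact hA _
    _ = _ := by
      congr 1
      have : Real.exp (η * T) = Real.exp (η * k * (T / (k + 1))) * Real.exp (η * (T / (k + 1))) := by
        rw [← Real.exp_add]; congr 1; field_simp
      rw [this]; ring

lemma orb_ratio (l w : L → ℝ) (l₀ : ℝ) (hl₀ : 0 < l₀)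
    (hl : ∀ γ, l₀ ≤ l γ) (hw : ∀ γ, 0 ≤ w γ) (η : ℝ) (hη : 0 < η)
    (hsum : ∀ σ, η < σ → Summable fun p => orbC l w p * Real.exp (-σ * orbLam l p))
    (hj : ∀ ε : ℝ, 0 < ε → ∃ R, ∀ p, R ≤ orbLam l p → orbC l w p * Real.exp (-η * orbLam l p) ≤ ε) :
    (∀ ε : ℝ, 0 < ε → ∃ R, ∀ γ, R ≤ l γ → w γ * Real.exp (-η * l γ) ≤ ε) ∧
    ∃ q : ℝ, 0 ≤ q ∧ q < 1 ∧ ∀ γ, w γ * Real.exp (-η * l γ) ≤ q := by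
  have hlp : ∀ γ, 0 < l γ := fun γ => hl₀.trans_le (hl γ)
  have hpow : ∀ p : L × ℕ, orbC l w p * Real.exp (-η * orbLam l p) = l p.1 * (w p.1 * Real.exp (-η * l p.1)) ^ (p.2 + 1) := by
    intro p
    unfold orbC orbLam
    rw [mul_pow, ← Real.exp_nat_mul]
    push_cast
    rw [mul_assoc]; congr 3; ring
  have hA : ∀ ε : ℝ, 0 < ε → ∃ R, ∀ γ, R ≤ l γ → w γ * Real.exp (-η * l γ) ≤ ε := by
    intro ε hε
    obtain ⟨R, hR⟩ := hj (l₀ * ε) (by positivity)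
    refine ⟨R, fun γ hγ => ?_⟩
    have h1 := hR (γ, 0) (by simpa [orbLam] using hγ)
    rw [hpow] at h1
    simp only [zero_add, pow_one] at h1
    have h2 : 0 ≤ w γ * Real.exp (-η * l γ) := mul_nonneg (hw γ) (Real.exp_pos _).le
    have h3 := hl γ
    by_contra! h4
    nlinarith
  refine ⟨hA, ?_⟩
  have hlt : ∀ γ, w γ * Real.exp (-η * l γ) < 1 := by
    intro γ
    by_contra! h
    obtain ⟨R, hR⟩ := hj (l₀ / 2) (by positivity)
    obtain ⟨n, hn⟩ := exists_nat_ge (R / l₀)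
    rw [div_le_iff₀ hl₀] at hn
    have h1 := hR (γ, n) (by
      unfold orbLam
      have := hl γ
      have : (0:ℝ) ≤ n := by positivity
      simp only
      nlinarith)
    rw [hpow] at h1
    have h2 : 1 ≤ (w γ * Real.exp (-η * l γ)) ^ (n + 1) := one_le_pow₀ h
    have h3 := hl γ
    simp only at h1
    nlinarith
  obtain ⟨R, hR⟩ := hA (1 / 2) (by norm_num)
  have hfin : {γ | 1 / 2 < w γ * Real.exp (-η * l γ)}.Finite := by
    have hinj : Function.Injective (fun γ : L => ((γ, 0) : L × ℕ)) := fun a b h => congrArg Prod.fst h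
    have h1 := ((hsum (2 * η) (by linarith)).comp_injective hinj).tendsto_cofinite_zero
    have h2 := h1.eventually_lt_const (show 0 < l₀ * Real.exp (-(η * R)) / 2 by positivity)
    refine (show {γ | ¬ _}.Finite from h2).subset ?_
    intro γ hγ
    have hγ' : 1 / 2 < w γ * Real.exp (-η * l γ) := hγ
    have hlR : l γ < R := by
      by_contra! h
      have := hR γ h
      linarith
    refine not_lt.mpr (show l₀ * Real.exp (-(η * R)) / 2 ≤
      orbC l w (γ, 0) * Real.exp (-(2 * η) * orbLam l (γ, 0)) from ?_)
    simp only [orbC, orbLam, Nat.cast_zero, zero_add, one_mul, pow_one]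
    have e : Real.exp (-(2 * η) * l γ) = Real.exp (-η * l γ) * Real.exp (-(η * l γ)) := by
      rw [← Real.exp_add]; congr 1; ring
    have e2 : Real.exp (-(η * R)) ≤ Real.exp (-(η * l γ)) := by
      apply Real.exp_le_exp.mpr; nlinarith
    rw [e]
    calc l₀ * Real.exp (-(η * R)) / 2 = l₀ * (1 / 2) * Real.exp (-(η * R)) := by ring
      _ ≤ l γ * (w γ * Real.exp (-η * l γ)) * Real.exp (-(η * l γ)) := by
        have := hlp γ
        gcongr
        exact hl γ
      _ = _ := by ring
  rcases Set.eq_empty_or_nonempty {γ | 1 / 2 < w γ * Real.exp (-η * l γ)} with he | hne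
  · refine ⟨1 / 2, by norm_num, by norm_num, fun γ => ?_⟩
    by_contra! h
    exact (Set.eq_empty_iff_forall_notMem.mp he γ) h
  · obtain ⟨γ₀, hγ₀, hmax⟩ := Set.exists_max_image _ (fun γ => w γ * Real.exp (-η * l γ)) hfin hne
    have hγ₀' : 1 / 2 < w γ₀ * Real.exp (-η * l γ₀) := hγ₀
    refine ⟨w γ₀ * Real.exp (-η * l γ₀), by linarith, hlt γ₀, fun γ => ?_⟩
    by_cases h : 1 / 2 < w γ * Real.exp (-η * l γ)
    · exact hmax γ h
    · linarith
end fin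

open MeasureTheory Filter Topology Set
section fin2
variable {L : Type*}

/-- the weights `k l(γ) w(γ)^k` -/
noncomputable def orbC1 (l w : L → ℝ) (p : L × ℕ) : ℝ := orbLam l p * w p.1 ^ (p.2 + 1)

lemma orb_higher (l w : L → ℝ) (l₀ : ℝ) (hl₀ : 0 < l₀)
    (hl : ∀ γ, l₀ ≤ l γ) (hw : ∀ γ, 0 ≤ w γ) (η : ℝ) (hη : 0 < η)
    (hsum : ∀ σ, η < σ → Summable fun p => orbC l w p * Real.exp (-σ * orbLam l p))
    (hH : Tendsto (fun T => Real.exp (-η * T) * cntA (orbC l w) (orbLam l) T) atTop (𝓝 (1 / η))) :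
    (∀ T, Summable fun p => (if orbLam l p ≤ T then orbC1 l w p else 0)) ∧
    Tendsto (fun T => Real.exp (-η * T) * cntA (orbC1 l w) (orbLam l) T) atTop (𝓝 (1 / η)) := by
  have hlp : ∀ γ, 0 < l γ := fun γ => hl₀.trans_le (hl γ)
  have hc : ∀ p, 0 ≤ orbC l w p := fun p => by
    have := hw p.1; have := hlp p.1; unfold orbC; positivity
  have hlam : ∀ p, 0 < orbLam l p := fun p => by
    have := hlp p.1; unfold orbLam; positivity
  have hs := cntA_summable (orbC l w) (orbLam l) hc (2 * η) (by linarith) (hsum _ (by linarith))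
  have hj := cntA_jump (orbC l w) (orbLam l) hc η hη hs hH
  obtain ⟨C, hC0, hC⟩ := cntA_bdd (orbC l w) (orbLam l) hc η hη hlam hs hH
  obtain ⟨hsmall, q, hq0, hq1, hq⟩ := orb_ratio l w l₀ hl₀ hl hw η hη hsum hj
  have ha1 : ∀ γ, w γ * Real.exp (-η * l γ) ≤ 1 := fun γ => (hq γ).trans hq1.le
  have hblock := orb_block l w hlp hw η hη hs ha1 C hC
  have ha0 : ∀ γ, 0 ≤ w γ * Real.exp (-η * l γ) := fun γ => mul_nonneg (hw γ) (Real.exp_pos _).le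
  -- the difference
  have hsD : ∀ T, Summable fun p : L × ℕ => (if orbLam l p ≤ T then (p.2:ℝ) * orbC l w p else 0) := by
    intro T
    refine Summable.of_nonneg_of_le (fun p => ?_) (fun p => ?_) ((hs T).mul_left (T / l₀))
    · have := hc p
      split_ifs
      · positivity
      · simp
    · split_ifs with h
      · have h1 : (p.2:ℝ) ≤ T / l₀ := by
          rw [le_div_iff₀ hl₀]
          unfold orbLam at h
          have := hl p.1
          have : (0:ℝ) ≤ p.2 := by positivity
          nlinarith
        exact mul_le_mul_of_nonneg_right h1 (hc p)
      · simp
  have hsplit : ∀ T, ∀ p : L × ℕ, (if orbLam l p ≤ T then orbC1 l w p else 0) =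
      (if orbLam l p ≤ T then orbC l w p else 0) + (if orbLam l p ≤ T then (p.2:ℝ) * orbC l w p else 0) := by
    intro T p
    split_ifs
    · unfold orbC1 orbC orbLam; ring
    · simp
  have hs1 : ∀ T, Summable fun p => (if orbLam l p ≤ T then orbC1 l w p else 0) := by
    intro T
    simp_rw [hsplit T]
    exact (hs T).add (hsD T)
  refine ⟨hs1, ?_⟩
  have hcnt : ∀ T, cntA (orbC1 l w) (orbLam l) T = cntA (orbC l w) (orbLam l) T +
      ∑' k : ℕ, (k:ℝ) * ∑' γ, (if ((k:ℝ) + 1) * l γ ≤ T then l γ * w γ ^ (k + 1) else 0) := by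
    intro T
    have e : ∑' k : ℕ, (k:ℝ) * ∑' γ, (if ((k:ℝ) + 1) * l γ ≤ T then l γ * w γ ^ (k + 1) else 0)
        = ∑' p : L × ℕ, (if orbLam l p ≤ T then (p.2:ℝ) * orbC l w p else 0) := by
      rw [(hsD T).tsum_prod]
      refine Eq.trans ?_ (Summable.tsum_comm (f := fun (γ : L) (k : ℕ) => (if orbLam l (γ, k) ≤ T then (k:ℝ) * orbC l w (γ, k) else 0)) (hsD T))
      congr 1; ext k
      rw [← tsum_mul_left]
      congr 1; ext γ
      by_cases h : ((k:ℝ) + 1) * l γ ≤ T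
      · rw [if_pos h, if_pos (show orbLam l (γ, k) ≤ T from h)]; rfl
      · rw [if_neg h, if_neg (show ¬ orbLam l (γ, k) ≤ T from h), mul_zero]
    rw [e]
    unfold cntA
    rw [← (hs T).tsum_add (hsD T)]
    congr 1; ext p
    exact hsplit T p
  have hBnn : ∀ (k : ℕ) T, 0 ≤ ∑' γ, (if ((k:ℝ) + 1) * l γ ≤ T then l γ * w γ ^ (k + 1) else 0) := by
    intro k T
    refine tsum_nonneg fun γ => ?_
    have := hlp γ; have := hw γ
    split_ifs
    · positivity
    · simp
  have hA0 : cntA (fun γ => l γ * w γ) l 0 = 0 := by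
    unfold cntA
    have : ∀ γ, ¬ l γ ≤ 0 := fun γ => not_le.mpr (hlp γ)
    simp [this]
  have hcancel : ∀ T, Real.exp (-η * T) * Real.exp (η * T) = 1 := fun T => by
    rw [← Real.exp_add]; simp
  have hdiff : Tendsto (fun T => ∑' k : ℕ, Real.exp (-η * T) * ((k:ℝ) * ∑' γ, (if ((k:ℝ) + 1) * l γ ≤ T then l γ * w γ ^ (k + 1) else 0)))
      atTop (𝓝 (∑' _ : ℕ, (0:ℝ))) := by
    apply tendsto_tsum_of_dominated_convergence (bound := fun k : ℕ => C * ((k:ℝ) * q ^ k))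
    · have := summable_pow_mul_geometric_of_norm_lt_one (R := ℝ) 1 (r := q) (by rw [Real.norm_of_nonneg hq0]; exact hq1)
      simpa using this.mul_left C
    · intro k
      rcases Nat.eq_zero_or_pos k with rfl | hk
      · simp
      have hk' : (0:ℝ) < k := by exact_mod_cast hk
      rw [tendsto_order]
      constructor
      · intro a ha
        refine Eventually.of_forall fun T => ha.trans_le ?_
        have := hBnn k T
        positivity
      · intro a ha
        set ρ : ℝ := min 1 (a / (2 * k * (C + 1))) with hρ
        have hρ0 : 0 < ρ := by
          rw [hρ]; apply lt_min one_pos; positivity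
        obtain ⟨R, hR⟩ := hsmall ρ hρ0
        have hlim : Tendsto (fun T : ℝ => Real.exp (-η * T) * (k * (Real.exp (η * k * R) * cntA (fun γ => l γ * w γ) l R))) atTop (𝓝 0) := by
          have h1 : Tendsto (fun T : ℝ => Real.exp (-η * T)) atTop (𝓝 0) :=
            Real.tendsto_exp_atBot.comp (tendsto_id.const_mul_atTop_of_neg (by linarith))
          simpa using h1.mul_const (k * (Real.exp (η * k * R) * cntA (fun γ => l γ * w γ) l R))
        filter_upwards [hlim.eventually_lt_const (half_pos ha)] with T hT
        have hb := hblock k R ρ T hρ0.le (fun γ hγ => by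
          calc (w γ * Real.exp (-η * l γ)) ^ k ≤ (w γ * Real.exp (-η * l γ)) ^ 1 :=
                pow_le_pow_of_le_one (ha0 γ) (ha1 γ) hk
            _ ≤ ρ := by rw [pow_one]; exact hR γ hγ.le)
        have h2 : k * (ρ * C) ≤ a / 2 := by
          have : ρ ≤ a / (2 * k * (C + 1)) := min_le_right _ _
          rw [le_div_iff₀ (by positivity)] at this
          nlinarith [mul_pos hρ0 hk']
        calc _ ≤ Real.exp (-η * T) * (k * (Real.exp (η * k * R) * cntA (fun γ => l γ * w γ) l R + ρ * C * Real.exp (η * T))) := by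
              gcongr
          _ = Real.exp (-η * T) * (k * (Real.exp (η * k * R) * cntA (fun γ => l γ * w γ) l R)) +
              k * (ρ * C) * (Real.exp (-η * T) * Real.exp (η * T)) := by ring
          _ < a := by rw [hcancel]; linarith
    · refine Eventually.of_forall fun T k => ?_
      have h0 := hBnn k T
      rw [Real.norm_of_nonneg (by positivity)]
      have hb := hblock k 0 (q ^ k) T (by positivity) (fun γ _ => pow_le_pow_left₀ (ha0 γ) (hq γ) k)
      rw [hA0, mul_zero, zero_add] at hb
      calc _ ≤ Real.exp (-η * T) * (k * (q ^ k * C * Real.exp (η * T))) := by gcongr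
        _ = C * (k * q ^ k) * (Real.exp (-η * T) * Real.exp (η * T)) := by ring
        _ = _ := by rw [hcancel, mul_one]
  have := hH.add hdiff
  simp only [tsum_zero, add_zero] at this
  refine this.congr fun T => ?_
  rw [hcnt T, tsum_mul_left]; ring

lemma orb_final (l w : L → ℝ) (l₀ : ℝ) (hl₀ : 0 < l₀)
    (hl : ∀ γ, l₀ ≤ l γ) (hw : ∀ γ, 0 ≤ w γ) (η : ℝ) (hη : 0 < η)
    (hs : ∀ T, Summable fun p => (if orbLam l p ≤ T then orbC1 l w p else 0))
    (hH : Tendsto (fun T => Real.exp (-η * T) * cntA (orbC1 l w) (orbLam l) T) atTop (𝓝 (1 / η))) :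
    Tendsto (fun T => cntA (fun p : L × ℕ => w p.1 ^ (p.2 + 1)) (orbLam l) T * (η * T * Real.exp (-η * T)))
      atTop (𝓝 1) := by
  have hlp : ∀ γ, 0 < l γ := fun γ => hl₀.trans_le (hl γ)
  have hlam : ∀ p, l₀ ≤ orbLam l p := fun p => by
    have := hl p.1; unfold orbLam
    have : (0:ℝ) ≤ p.2 := by positivity
    nlinarith [hlp p.1]
  have hv : ∀ p : L × ℕ, 0 ≤ w p.1 ^ (p.2 + 1) := fun p => pow_nonneg (hw _) _
  have hc1 : ∀ p, 0 ≤ orbC1 l w p := fun p => mul_nonneg (hl₀.le.trans (hlam p)) (hv p)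
  have hle0 : ∀ p : L × ℕ, w p.1 ^ (p.2 + 1) ≤ orbC1 l w p / l₀ := by
    intro p
    rw [le_div_iff₀ hl₀]; unfold orbC1
    nlinarith [hv p, hlam p]
  have hsv : ∀ T, Summable fun p : L × ℕ => (if orbLam l p ≤ T then w p.1 ^ (p.2 + 1) else 0) := by
    intro T
    refine Summable.of_nonneg_of_le (fun p => ?_) (fun p => ?_) ((hs T).div_const l₀)
    · split_ifs
      · exact hv p
      · simp
    · split_ifs
      · exact hle0 p
      · simp
  have hlo : ∀ T, cntA (orbC1 l w) (orbLam l) T ≤ T * cntA (fun p : L × ℕ => w p.1 ^ (p.2 + 1)) (orbLam l) T := by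
    intro T
    unfold cntA
    rw [← tsum_mul_left]
    refine (hs T).tsum_le_tsum (fun p => ?_) ((hsv T).mul_left T)
    split_ifs with h
    · exact mul_le_mul_of_nonneg_right h (hv p)
    · simp
  have hup : ∀ θ T, 0 < θ → θ < 1 → 0 < T → cntA (fun p : L × ℕ => w p.1 ^ (p.2 + 1)) (orbLam l) T ≤
      cntA (orbC1 l w) (orbLam l) T / (θ * T) + cntA (orbC1 l w) (orbLam l) (θ * T) / l₀ := by
    intro θ T h0 h1 hT
    unfold cntA
    rw [← tsum_div_const, ← tsum_div_const, ← ((hs T).div_const _).tsum_add ((hs (θ * T)).div_const _)]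
    refine (hsv T).tsum_le_tsum (fun p => ?_) (((hs T).div_const _).add ((hs (θ * T)).div_const _))
    have hcp := hc1 p
    have hθT : 0 < θ * T := by positivity
    by_cases ha : orbLam l p ≤ θ * T
    · have hb : orbLam l p ≤ T := ha.trans (by nlinarith)
      rw [if_pos ha, if_pos hb, if_pos hb]
      have := hle0 p
      have : 0 ≤ orbC1 l w p / (θ * T) := by positivity
      linarith
    · rw [if_neg ha]
      split_ifs with hb
      · rw [zero_div, add_zero, le_div_iff₀ hθT]; unfold orbC1
        rw [mul_comm]
        exact mul_le_mul_of_nonneg_right (not_le.mp ha).le (hv p)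
      · simp
  rw [tendsto_order]
  constructor
  · intro a ha
    have h1 : Tendsto (fun T => η * (Real.exp (-η * T) * cntA (orbC1 l w) (orbLam l) T)) atTop (𝓝 1) := by
      simpa [hη.ne'] using hH.const_mul η
    filter_upwards [h1.eventually_const_lt ha] with T hT
    refine hT.trans_le ?_
    calc _ ≤ η * (Real.exp (-η * T) * (T * cntA (fun p : L × ℕ => w p.1 ^ (p.2 + 1)) (orbLam l) T)) := by
          gcongr; exact hlo T
      _ = _ := by ring
  · intro a ha
    obtain ⟨b, hb1, hb2⟩ := exists_between ha
    have hb0 : 0 < b := by linarith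
    set θ := 1 / b with hθ
    have hθ0 : 0 < θ := by positivity
    have hθ1 : θ < 1 := by rw [hθ, div_lt_one hb0]; exact hb1
    have h1 : Tendsto (fun T => η / θ * (Real.exp (-η * T) * cntA (orbC1 l w) (orbLam l) T)) atTop (𝓝 b) := by
      have := hH.const_mul (η / θ)
      have e : η / θ * (1 / η) = b := by rw [hθ]; field_simp
      rwa [e] at this
    have h2 : Tendsto (fun T : ℝ => η / l₀ * (T * Real.exp (-(η * (1 - θ)) * T)) * (Real.exp (-η * (θ * T)) * cntA (orbC1 l w) (orbLam l) (θ * T))) atTop (𝓝 0) := by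
      have e1 : Tendsto (fun T : ℝ => T * Real.exp (-(η * (1 - θ)) * T)) atTop (𝓝 0) := by
        have := tendsto_rpow_mul_exp_neg_mul_atTop_nhds_zero 1 (η * (1 - θ)) (mul_pos hη (by linarith))
        simpa using this
      have e2 := hH.comp (tendsto_id.const_mul_atTop hθ0)
      have := (e1.const_mul (η / l₀)).mul e2
      simpa [Function.comp_def] using this
    have h3 := h1.add h2
    rw [add_zero] at h3
    filter_upwards [h3.eventually_lt_const hb2, eventually_gt_atTop 0] with T hT hT0
    refine lt_of_le_of_lt ?_ hT
    calc _ ≤ (cntA (orbC1 l w) (orbLam l) T / (θ * T) + cntA (orbC1 l w) (orbLam l) (θ * T) / l₀) * (η * T * Real.exp (-η * T)) := by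
          gcongr; exact hup θ T hθ0 hθ1 hT0
      _ = _ := by
          have e : Real.exp (-η * T) = Real.exp (-(η * (1 - θ)) * T) * Real.exp (-η * (θ * T)) := by
            rw [← Real.exp_add]; congr 1; ring
          rw [add_mul]
          congr 1
          · field_simp
          · rw [e]; field_simp
end fin2

theorem weighted_prime_orbit_theorem
    {L : Type*} [Countable L] (l : L → ℝ) (l₀ : ℝ) (hl₀ : 0 < l₀)
    (hl : ∀ γ, l₀ ≤ l γ) (w : L → ℝ) (hw : ∀ γ, 0 ≤ w γ) (η : ℝ) (hη : 0 < η)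
    (hconv : ∀ σ : ℝ, η < σ →
      Summable (fun p : L × ℕ =>
        w p.1 ^ (p.2 + 1) * Real.exp (-((p.2 : ℝ) + 1) * σ * l p.1) /
          ((p.2 : ℝ) + 1)))
    (hext : ∃ U : Set ℂ, IsOpen U ∧ {s : ℂ | η ≤ s.re} ⊆ U ∧
      ∃ g : ℂ → ℂ, AnalyticOnNhd ℂ g U ∧ (∀ s ∈ U, g s ≠ 0) ∧
        ∀ s ∈ U, η < s.re →
          Complex.exp (zetaLog l w s) = g s / (s - (η : ℂ))) :
    Filter.Tendsto
      (fun T : ℝ =>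
        (∑' p : {p : L × ℕ // ((p.2 : ℝ) + 1) * l p.1 ≤ T},
            w p.1.1 ^ (p.1.2 + 1)) /
          (Real.exp (η * T) / (η * T)))
      Filter.atTop (nhds 1) := by
  have hsum := orb_summable l w l₀ hl₀ hl hw η hconv
  have hH := orb_wi l w l₀ hl₀ hl hw η hη hconv hext
  obtain ⟨hs, hH1⟩ := orb_higher l w l₀ hl₀ hl hw η hη hsum hH
  refine (orb_final l w l₀ hl₀ hl hw η hη hs hH1).congr fun T => ?_
  have e : ∑' p : {p : L × ℕ // ((p.2 : ℝ) + 1) * l p.1 ≤ T}, w p.1.1 ^ (p.1.2 + 1) =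
      cntA (fun p : L × ℕ => w p.1 ^ (p.2 + 1)) (orbLam l) T := by
    have := tsum_subtype {p : L × ℕ | ((p.2 : ℝ) + 1) * l p.1 ≤ T} (fun p => w p.1 ^ (p.2 + 1))
    refine this.trans ?_
    unfold cntA
    refine tsum_congr fun p => ?_
    by_cases h : ((p.2 : ℝ) + 1) * l p.1 ≤ T
    · rw [Set.indicator_of_mem (show p ∈ {p : L × ℕ | ((p.2 : ℝ) + 1) * l p.1 ≤ T} from h), if_pos (show orbLam l p ≤ T from h)]
    · rw [Set.indicator_of_notMem (show p ∉ {p : L × ℕ | ((p.2 : ℝ) + 1) * l p.1 ≤ T} from h), if_neg (show ¬ orbLam l p ≤ T from h)]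
  rw [e, div_div_eq_mul_div, neg_mul, Real.exp_neg]
  rw [div_eq_mul_inv]; ring
end
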